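/- arXiv:2202.12945 — 5 statements merged into one kernel-verified Lean document; each statement's English description precedes it below -/
import Mathlib

section
/- Let X be a real Banach space and let S be a bounded subset of X. Then μ(S) = 0 if and only if the weak closure of S is weakly compact (i.e., S is relatively weakly compact). -/
open Filter Topology Pointwise

variable {X : Type*} [NormedAddCommGroup X] [NormedSpace ℝ X]

/-- `u` converges weakly to `x`. -/
def WeakConv (u : ℕ → X) (x : X) : Prop :=
  ∀ f : X →L[ℝ] ℝ, Tendsto (fun n => f (u n)) atTop (𝓝 (f x))

/-- A set is weakly compact if it is compact in the weak topology `σ(X, X*)`. -/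
def WeaklyCompact (K : Set X) : Prop :=
  IsCompact (toWeakSpace ℝ X '' K)

/-- The closure of a set in the weak topology. -/
def weakClosure (S : Set X) : Set X :=
  toWeakSpace ℝ X ⁻¹' closure (toWeakSpace ℝ X '' S)

/-- A set is relatively weakly compact if its weak closure is weakly compact. -/
def RelWeaklyCompact (S : Set X) : Prop :=
  WeaklyCompact (weakClosure S)

/-- The De Blasi measure of weak noncompactness. -/
noncomputable def deBlasi (S : Set X) : ℝ :=
  sInf {r : ℝ | 0 ≤ r ∧ ∃ K : Set X, WeaklyCompact K ∧ S ⊆ K + Metric.closedBall (0 : X) r}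

/-- A point approximated arbitrarily well by the range of an isometry from a complete space
lies at distance zero from a point of that range. -/
theorem Isometry.exists_dist_eq_zero {E F : Type*} [PseudoMetricSpace E] [CompleteSpace E]
    [PseudoMetricSpace F] {f : E → F} (hf : Isometry f) {y : F}
    (h : ∀ ε > 0, ∃ x, dist y (f x) < ε) : ∃ x, dist y (f x) = 0 := by
  obtain ⟨u, hu, hlim⟩ := mem_closure_iff_seq_limit.1 (Metric.mem_closure_range_iff.2 h)
  obtain ⟨_, ⟨x, rfl⟩, hx⟩ := cauchySeq_tendsto_of_isComplete
    hf.isUniformInducing.isComplete_range hu hlim.cauchySeq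
  exact ⟨x, Metric.inseparable_iff.1 (tendsto_nhds_unique_inseparable hlim hx)⟩

open NormedSpace in
/-- If `S` lies within distance `r` of a weakly compact set, then every point of the weak-star
closure of `S` in the bidual lies within distance `r` of the canonical image of `X`. -/
theorem exists_norm_sub_inclusionInDoubleDual_le {S K : Set X} {r : ℝ} (hK : WeaklyCompact K)
    (hSK : S ⊆ K + Metric.closedBall (0 : X) r) {φ : WeakDual ℝ (StrongDual ℝ X)}
    (hφ : φ ∈ closure (inclusionInDoubleDualWeak ℝ X '' (toWeakSpace ℝ X '' S))) :
    ∃ x : X, ‖WeakDual.toStrongDual φ - inclusionInDoubleDual ℝ X x‖ ≤ r := by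
  have hclosed : IsClosed (inclusionInDoubleDualWeak ℝ X '' (toWeakSpace ℝ X '' K) +
      WeakDual.toStrongDual ⁻¹' Metric.closedBall (0 : StrongDual ℝ (StrongDual ℝ X)) r) :=
    ((hK.image (map_continuous _)).add (WeakDual.isCompact_closedBall 0 r)).isClosed
  have hsub : inclusionInDoubleDualWeak ℝ X '' (toWeakSpace ℝ X '' S) ⊆
      inclusionInDoubleDualWeak ℝ X '' (toWeakSpace ℝ X '' K) +
        WeakDual.toStrongDual ⁻¹' Metric.closedBall (0 : StrongDual ℝ (StrongDual ℝ X)) r := by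
    rintro _ ⟨_, ⟨s, hs, rfl⟩, rfl⟩
    obtain ⟨k, hk, b, hb, rfl⟩ := hSK hs
    refine ⟨_, ⟨_, ⟨k, hk, rfl⟩, rfl⟩, inclusionInDoubleDualWeak ℝ X (toWeakSpace ℝ X b), ?_, ?_⟩
    · rw [mem_closedBall_zero_iff] at hb
      refine (mem_closedBall_zero_iff (E := StrongDual ℝ (StrongDual ℝ X))).2 ?_
      exact (double_dual_bound ℝ X b).trans hb
    · simp
  obtain ⟨_, ⟨_, ⟨k, -, rfl⟩, rfl⟩, ψ, hψ, rfl⟩ := closure_minimal hsub hclosed hφ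
  refine ⟨k, le_of_eq_of_le (congrArg norm ?_)
    ((mem_closedBall_zero_iff (E := StrongDual ℝ (StrongDual ℝ X))).1 hψ)⟩
  exact add_sub_cancel_left (inclusionInDoubleDual ℝ X k) (WeakDual.toStrongDual ψ)

theorem deBlasi_nonneg (S : Set X) : 0 ≤ deBlasi S :=
  Real.sInf_nonneg fun _ hr => hr.1

/-- A bounded set lies within distance `r` of a weakly compact set for each `r` above its
De Blasi measure. -/
theorem exists_weaklyCompact_of_deBlasi_lt {S : Set X} (hS : Bornology.IsBounded S) {ε : ℝ}
    (hε : deBlasi S < ε) :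
    ∃ r < ε, ∃ K : Set X, WeaklyCompact K ∧ S ⊆ K + Metric.closedBall (0 : X) r := by
  obtain ⟨R, hR, hSR⟩ := hS.subset_closedBall_lt 0 (0 : X)
  have hne : {r : ℝ | 0 ≤ r ∧ ∃ K : Set X, WeaklyCompact K ∧
      S ⊆ K + Metric.closedBall (0 : X) r}.Nonempty :=
    ⟨R, hR.le, {0}, ((Set.finite_singleton 0).image _).isCompact, by simpa using hSR⟩
  obtain ⟨r, hr, hlt⟩ := exists_lt_of_csInf_lt hne hε
  exact ⟨r, hlt, hr.2⟩

theorem subset_weakClosure (S : Set X) : S ⊆ weakClosure S :=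
  fun x hx => show toWeakSpace ℝ X x ∈ closure (toWeakSpace ℝ X '' S) from
    subset_closure (Set.mem_image_of_mem _ hx)

/-- For a bounded subset `S` of a real Banach space, `μ(S) = 0` iff the
weak closure of `S` is weakly compact (i.e. `S` is relatively weakly compact). -/
theorem deBlasi_eq_zero_iff_relWeaklyCompact {X : Type*} [NormedAddCommGroup X]
    [NormedSpace ℝ X] [CompleteSpace X] (S : Set X) (hS : Bornology.IsBounded S) :
    deBlasi S = 0 ↔ WeaklyCompact (weakClosure S) := by
  constructor
  · intro h
    rw [weakClosure, WeaklyCompact, Set.image_preimage_eq _ (toWeakSpace ℝ X).surjective]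
    refine NormedSpace.isCompact_closure_of_isBounded _ _ _ ?_ fun φ hφ => ?_
    · rwa [Set.preimage_image_eq _ (toWeakSpace ℝ X).injective]
    obtain ⟨x, hx⟩ := (NormedSpace.inclusionInDoubleDualLi (E := X) ℝ).isometry.exists_dist_eq_zero
      (y := WeakDual.toStrongDual φ) fun ε hε => by
        obtain ⟨r, hr, K, hK, hSK⟩ := exists_weaklyCompact_of_deBlasi_lt hS (h.trans_lt hε)
        obtain ⟨x, hx⟩ := exists_norm_sub_inclusionInDoubleDual_le hK hSK hφ
        exact ⟨x, (dist_eq_norm _ _).trans_lt (hx.trans_lt hr)⟩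
    rw [dist_eq_norm, ContinuousLinearMap.opNorm_zero_iff] at hx
    exact ⟨toWeakSpace ℝ X x, (sub_eq_zero.1 hx).symm⟩
  · intro h
    refine le_antisymm (csInf_le ⟨0, fun r hr => hr.1⟩ ⟨le_rfl, _, h, ?_⟩) (deBlasi_nonneg S)
    simpa using subset_weakClosure S
end

section
/- Let X be a real Banach space and let S be a bounded subset of X. Then the De Blasi measure of weak noncompactness of the convex hull of S equals that of S: μ(co(S)) = μ(S). -/
open Filter Topology Pointwise

variable {X : Type*} [NormedAddCommGroup X] [NormedSpace ℝ X]

open MeasureTheory CompactlySupported in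
/-- A linear functional on a space of continuous functions on a compact space that is dominated
by the maximum is integration against a finite measure. -/
theorem exists_measure_integral_eq_of_le {κ E : Type*} [TopologicalSpace κ] [CompactSpace κ]
    [T2Space κ] [Nonempty κ] [MeasurableSpace κ] [BorelSpace κ] [AddCommGroup E] [Module ℝ E]
    (T : E →ₗ[ℝ] C_c(κ, ℝ)) (φ : E →ₗ[ℝ] ℝ) (h : ∀ f c, (∀ k, T f k ≤ c) → φ f ≤ c) :
    ∃ ν : Measure κ, IsFiniteMeasure ν ∧ ∀ f, φ f = ∫ k, T f k ∂ν := by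
  have hker : LinearMap.ker T ≤ LinearMap.ker φ := by
    intro f hf
    rw [LinearMap.mem_ker] at hf ⊢
    refine le_antisymm (h f 0 fun k => by simp [hf]) ?_
    have := h (-f) 0 fun k => by simp [hf]
    simpa using this
  let p : C_c(κ, ℝ) →ₗ.[ℝ] ℝ :=
    ⟨LinearMap.range T, ((LinearMap.ker T).liftQ φ hker) ∘ₗ T.quotKerEquivRange.symm.toLinearMap⟩
  have hp : ∀ f, p ⟨T f, LinearMap.mem_range_self T f⟩ = φ f := by
    intro f
    have : T.quotKerEquivRange.symm ⟨T f, LinearMap.mem_range_self T f⟩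
        = (LinearMap.ker T).mkQ f := T.quotKerEquivRange_symm_apply_image f _
    change (LinearMap.ker T).liftQ φ hker (T.quotKerEquivRange.symm _) = _
    rw [this]
    simp
  have hbdd : ∀ f : C_c(κ, ℝ), BddAbove (Set.range f) := fun f =>
    (isCompact_range f.continuous).bddAbove
  obtain ⟨Λ, hΛ, hle⟩ := exists_extension_of_le_sublinear p (fun f => ⨆ k, f k)
    (fun c hc f => by simp [Real.mul_iSup_of_nonneg hc.le])
    (fun f g => ciSup_le fun k => add_le_add (le_ciSup (hbdd f) k) (le_ciSup (hbdd g) k))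
    (by
      rintro ⟨_, f, rfl⟩
      rw [hp]
      exact h f _ fun k => le_ciSup (hbdd (T f)) k)
  let L : C_c(κ, ℝ) →ₚ[ℝ] ℝ := PositiveLinearMap.mk₀ Λ fun f hf => by
    have : Λ (-f) ≤ 0 := (hle (-f)).trans (ciSup_le fun k => by simpa using hf k)
    simpa using this
  refine ⟨RealRMK.rieszMeasure L, ?_, fun f => ?_⟩
  · infer_instance
  · rw [RealRMK.integral_rieszMeasure]
    exact ((hΛ ⟨T f, LinearMap.mem_range_self T f⟩).trans (hp f)).symm

/-- A bidual element that is small on the unit functionals annihilating some finite set, for each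
level of smallness, comes from the space. -/
theorem mem_range_inclusionInDoubleDual_of_forall_finite {X : Type*} [NormedAddCommGroup X]
    [NormedSpace ℝ X] [CompleteSpace X] (φ : StrongDual ℝ (StrongDual ℝ X))
    (h : ∀ ε > 0, ∃ F : Finset X, ∀ f : StrongDual ℝ X, ‖f‖ ≤ 1 → (∀ x ∈ F, f x = 0) → φ f ≤ ε) :
    φ ∈ Set.range (NormedSpace.inclusionInDoubleDual ℝ X) := by
  have hclosed : IsClosed (Set.range (NormedSpace.inclusionInDoubleDual ℝ X)) := by
    exact (NormedSpace.inclusionInDoubleDualLi ℝ (E := X)).isometry.isUniformInducing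
      |>.isComplete_range.isClosed
  rw [← hclosed.closure_eq]
  refine (Metric.mem_closure_iff (α := StrongDual ℝ (StrongDual ℝ X))).2 ?_
  intro ε hε
  obtain ⟨F, hF⟩ := h (ε / 2) (by positivity)
  let J : F → StrongDual ℝ X →ₗ[ℝ] ℝ := fun x =>
    (NormedSpace.inclusionInDoubleDual ℝ X (x : X)).toLinearMap
  let Y : Submodule ℝ (StrongDual ℝ X) := ⨅ x, LinearMap.ker (J x)
  have hY : ∀ f ∈ Y, ∀ x ∈ F, f x = 0 := fun f hf x hx =>
    LinearMap.mem_ker.1 ((Submodule.mem_iInf _).1 hf ⟨x, hx⟩)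
  have hle : ∀ f ∈ Y, φ f ≤ ε / 2 * ‖f‖ := by
    intro f hf
    rcases eq_or_ne f 0 with rfl | h0
    · simp
    have hn : 0 < ‖f‖ := norm_pos_iff.2 h0
    have := hF (‖f‖⁻¹ • f) (by simp [norm_smul, hn.ne']) fun x hx => by simp [hY f hf x hx]
    rw [map_smul, smul_eq_mul, inv_mul_le_iff₀ hn] at this
    linarith
  obtain ⟨ψ, hψ, hψn⟩ := exists_extension_norm_eq Y (φ.comp Y.subtypeL)
  have hnorm : ‖ψ‖ ≤ ε / 2 := by
    rw [hψn]
    refine ContinuousLinearMap.opNorm_le_bound _ (by positivity) fun f => ?_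
    rw [Real.norm_eq_abs, abs_le']
    refine ⟨hle f f.2, ?_⟩
    have := hle (-f) (Y.neg_mem f.2)
    simpa using this
  have hspan := mem_span_of_iInf_ker_le_ker (L := J) (K := (φ - ψ).toLinearMap) fun f hf => by
    have := hψ ⟨f, hf⟩
    simp_all
  obtain ⟨c, hc⟩ := (Submodule.mem_span_range_iff_exists_fun ℝ).1 hspan
  refine ⟨_, ⟨∑ x, c x • (x : X), rfl⟩, ?_⟩
  have : NormedSpace.inclusionInDoubleDual ℝ X (∑ x, c x • (x : X)) = φ - ψ := by
    ext f
    rw [← ContinuousLinearMap.coe_coe (φ - ψ), ← hc]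
    simp [J]
  rw [this]
  calc dist φ (φ - ψ) = ‖φ - (φ - ψ)‖ := dist_eq_norm φ (φ - ψ)
    _ = ‖ψ‖ := congrArg norm (sub_sub_cancel φ ψ)
    _ < ε := by linarith

/-- Finite approximation of a compact space by points with respect to finitely many functions. -/
theorem exists_finset_forall_abs_sub_lt {κ X : Type*} [TopologicalSpace κ] [CompactSpace κ]
    [NormedAddCommGroup X] [NormedSpace ℝ X] (ι : κ → X)
    (hι : ∀ f : StrongDual ℝ X, Continuous fun k => f (ι k)) (G : Finset (StrongDual ℝ X))
    {ε : ℝ} (hε : 0 < ε) :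
    ∃ F : Finset κ, ∀ k, ∃ d ∈ F, ∀ g ∈ G, |g (ι d) - g (ι k)| < ε := by
  obtain ⟨F, -, hF⟩ := isCompact_univ.elim_nhds_subcover
    (fun d => {k : κ | ∀ g ∈ G, |g (ι d) - g (ι k)| < ε}) fun d _ => by
      have : ∀ g ∈ G, ∀ᶠ k in 𝓝 d, |g (ι d) - g (ι k)| < ε := fun g _ => by
        have hc : Continuous fun k => |g (ι d) - g (ι k)| := (continuous_const.sub (hι g)).abs
        exact hc.continuousAt.eventually_lt continuousAt_const (by simpa only [sub_self, abs_zero])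
      exact (Filter.eventually_all_finset G).2 this
  refine ⟨F, fun k => ?_⟩
  simpa using hF (Set.mem_univ k)

/-- If bounded functionals `g n` vanish eventually on points that approximate a weakly compact
family, then they tend to zero on the family. -/
theorem tendsto_zero_of_approx {κ X : Type*} [TopologicalSpace κ] [CompactSpace κ]
    [NormedAddCommGroup X] [NormedSpace ℝ X] (ι : κ → X)
    (hι : ∀ f : StrongDual ℝ X, Continuous fun k => f (ι k)) (g : ℕ → StrongDual ℝ X)
    (hg : ∀ n, ‖g n‖ ≤ 1) (D : Set κ) (hD : ∀ d ∈ D, ∀ᶠ n in atTop, g n (ι d) = 0)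
    (happ : ∀ k, ∃ d : ℕ → κ, (∀ n, d n ∈ D) ∧
      ∀ i, Tendsto (fun n => g i (ι (d n))) atTop (𝓝 (g i (ι k)))) (k : κ) :
    Tendsto (fun n => g n (ι k)) atTop (𝓝 0) := by
  rw [tendsto_iff_ultrafilter]
  intro U hU
  obtain ⟨γ, -, hγ⟩ := isCompact_iff_ultrafilter_le_nhds.1
    (WeakDual.isCompact_closedBall (𝕜 := ℝ) (0 : StrongDual ℝ X) 1)
    (U.map fun n => StrongDual.toWeakDual (g n)) (by
      refine Filter.le_principal_iff.2 (Filter.eventually_map.2 <| Eventually.of_forall fun n => ?_)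
      simpa using hg n)
  have hγ' : ∀ x, Tendsto (fun n => g n x) U (𝓝 (γ x)) := fun x =>
    ((WeakDual.eval_continuous x).tendsto γ).comp hγ
  have hγD : ∀ d ∈ D, γ (ι d) = 0 := fun d hd =>
    tendsto_nhds_unique (hγ' (ι d)) <|
      (tendsto_congr' ((hD d hd).filter_mono hU)).2 tendsto_const_nhds
  obtain ⟨d, hdD, hd⟩ := happ k
  obtain ⟨l, -, hl⟩ := isCompact_iff_ultrafilter_le_nhds.1 (isCompact_univ (X := κ))
    ((Filter.hyperfilter ℕ).map d) (by simp)
  have hlim : ∀ f : StrongDual ℝ X,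
      Tendsto (fun n => f (ι (d n))) (Filter.hyperfilter ℕ) (𝓝 (f (ι l))) := fun f =>
    ((hι f).tendsto l).comp hl
  have hgl : ∀ i, g i (ι k) = g i (ι l) := fun i =>
    tendsto_nhds_unique ((hd i).mono_left Nat.hyperfilter_le_atTop) (hlim (g i))
  have hγl : γ (ι l) = 0 := by
    refine tendsto_nhds_unique (hlim γ.toStrongDual) ?_
    have : (fun n => γ.toStrongDual (ι (d n))) = fun _ => 0 := funext fun n => hγD _ (hdD n)
    rw [this]
    exact tendsto_const_nhds
  have := hγ' (ι l)
  rw [hγl] at this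
  simpa only [hgl] using this

open MeasureTheory in
/-- Integration over a weakly compact family is, up to `ε`, controlled by finitely many points. -/
theorem exists_finset_integral_le {κ X : Type*} [TopologicalSpace κ] [CompactSpace κ]
    [MeasurableSpace κ] [BorelSpace κ] [NormedAddCommGroup X] [NormedSpace ℝ X] (ι : κ → X)
    (hι : ∀ f : StrongDual ℝ X, Continuous fun k => f (ι k)) {M : ℝ} (hM : ∀ k, ‖ι k‖ ≤ M)
    (ν : Measure κ) [IsFiniteMeasure ν] {ε : ℝ} (hε : 0 < ε) :
    ∃ F : Finset κ, ∀ f : StrongDual ℝ X, ‖f‖ ≤ 1 → (∀ k ∈ F, f (ι k) = 0) →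
      ∫ k, f (ι k) ∂ν ≤ ε := by
  classical
  by_contra! hcon
  choose pick hpick1 hpick0 hpickε using hcon
  choose dense hdense using fun (n : ℕ) (G : Finset (StrongDual ℝ X)) =>
    exists_finset_forall_abs_sub_lt ι hι G (Nat.one_div_pos_of_nat (α := ℝ) (n := n))
  let s : ℕ → Finset (StrongDual ℝ X) × Finset κ := fun n => Nat.rec (∅, ∅)
    (fun n s => (insert (pick s.2) s.1, s.2 ∪ dense n (insert (pick s.2) s.1))) n
  have hs1 : ∀ n, (s (n + 1)).1 = insert (pick (s n).2) (s n).1 := fun n => rfl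
  have hs2 : ∀ n, (s (n + 1)).2 = (s n).2 ∪ dense n (s (n + 1)).1 := fun n => rfl
  have hmono1 : Monotone fun n => (s n).1 := monotone_nat_of_le_succ fun n => by
    rw [hs1]; exact Finset.subset_insert _ _
  have hmono2 : Monotone fun n => (s n).2 := monotone_nat_of_le_succ fun n => by
    rw [hs2]; exact Finset.subset_union_left
  let g : ℕ → StrongDual ℝ X := fun n => pick (s n).2
  have hgmem : ∀ i n, i ≤ n → g i ∈ (s (n + 1)).1 := fun i n hin =>
    hmono1 (Nat.succ_le_succ hin) (by change g i ∈ (s (i + 1)).1; rw [hs1]; exact Finset.mem_insert_self _ _)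
  have hzero : ∀ k, Tendsto (fun n => g n (ι k)) atTop (𝓝 0) := by
    refine tendsto_zero_of_approx ι hι g (fun n => hpick1 _) (⋃ n, ((s n).2 : Set κ)) ?_ ?_
    · intro d hd
      obtain ⟨m, hm⟩ := Set.mem_iUnion.1 hd
      filter_upwards [eventually_ge_atTop m] with n hn
      exact hpick0 _ d (hmono2 hn hm)
    · intro k
      choose d hd hdk using fun n => hdense n (s (n + 1)).1 k
      refine ⟨d, fun n => Set.mem_iUnion.2 ⟨n + 1, ?_⟩, fun i => ?_⟩
      · rw [hs2]
        exact Finset.mem_union_right _ (hd n)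
      · rw [tendsto_iff_dist_tendsto_zero]
        refine squeeze_zero' (Eventually.of_forall fun n => dist_nonneg) ?_
          (tendsto_one_div_add_atTop_nhds_zero_nat (𝕜 := ℝ))
        filter_upwards [eventually_ge_atTop i] with n hn
        exact (hdk n (g i) (hgmem i n hn)).le
  have hint : Tendsto (fun n => ∫ k, g n (ι k) ∂ν) atTop (𝓝 (∫ _, (0 : ℝ) ∂ν)) := by
    refine tendsto_integral_of_dominated_convergence (fun _ => M)
      (fun n => (hι (g n)).aestronglyMeasurable) (integrable_const M) (fun n => ?_)
      (Eventually.of_forall hzero)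
    refine Eventually.of_forall fun k => ((g n).le_of_opNorm_le (hpick1 _) (ι k)).trans ?_
    simpa using hM k
  have := ge_of_tendsto' hint fun n => (hpickε (s n).2).le
  simp at this
  linarith

/-- **Krein's theorem**: a weakly compact set is contained in a weakly compact convex set. -/
theorem WeaklyCompact.exists_convex_superset {X : Type*} [NormedAddCommGroup X] [NormedSpace ℝ X]
    [CompleteSpace X] {K : Set X} (hK : WeaklyCompact K) :
    ∃ L : Set X, WeaklyCompact L ∧ Convex ℝ L ∧ K ⊆ L := by
  rcases K.eq_empty_or_nonempty with rfl | hne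
  · exact ⟨∅, hK, convex_empty, subset_rfl⟩
  let κ : Type _ := toWeakSpace ℝ X '' K
  have : CompactSpace κ := isCompact_iff_compactSpace.1 hK
  have : Nonempty κ := (hne.image _).to_subtype
  let _ : MeasurableSpace κ := borel κ
  have : BorelSpace κ := ⟨rfl⟩
  let ι : κ → X := fun k => (toWeakSpace ℝ X).symm k
  have hιK : ∀ x ∈ K, ∃ k, ι k = x := fun x hx => ⟨⟨_, x, hx, rfl⟩, by simp [ι]⟩
  have hι : ∀ f : StrongDual ℝ X, Continuous fun k => f (ι k) := fun f =>
    (WeakBilin.eval_continuous (topDualPairing ℝ X).flip f).comp continuous_subtype_val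
  obtain ⟨M, hM⟩ : ∃ M, ∀ k, ‖ι k‖ ≤ M := by
    obtain ⟨M, hM⟩ := banach_steinhaus
      (g := fun k => NormedSpace.inclusionInDoubleDual ℝ X (ι k)) fun f => by
        obtain ⟨C, hC⟩ := (isCompact_range (hι f)).isBounded.exists_norm_le
        exact ⟨C, fun k => hC _ ⟨k, rfl⟩⟩
    exact ⟨M, fun k => ((NormedSpace.inclusionInDoubleDualLi ℝ).norm_map (ι k)).symm.trans_le
      (hM k)⟩
  let A : Set (WeakDual ℝ (StrongDual ℝ X)) :=
    {φ | ∀ (f : StrongDual ℝ X) (c : ℝ), (∀ k, f (ι k) ≤ c) → φ f ≤ c}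
  have hAclosed : IsClosed A := by
    simp only [A, Set.ofPred_forall]
    exact isClosed_iInter fun f => isClosed_iInter fun c => isClosed_iInter fun _ =>
      isClosed_le (WeakDual.eval_continuous f) continuous_const
  have hAbdd : Bornology.IsBounded A := by
    refine (WeakDual.isBounded_closedBall (𝕜 := ℝ) (0 : StrongDual ℝ (StrongDual ℝ X)) M).subset ?_
    intro φ hφ
    have hle : ∀ f : StrongDual ℝ X, φ f ≤ M * ‖f‖ := fun f => hφ f _ fun k => by
      calc f (ι k) ≤ ‖f (ι k)‖ := le_abs_self _
        _ ≤ ‖f‖ * ‖ι k‖ := f.le_opNorm _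
        _ ≤ M * ‖f‖ := by rw [mul_comm]; gcongr; exact hM k
    have hM0 : 0 ≤ M := (norm_nonneg _).trans (hM (Classical.arbitrary κ))
    simp only [Set.mem_preimage, mem_closedBall_zero_iff]
    refine ContinuousLinearMap.opNorm_le_bound _ hM0 fun f => ?_
    rw [Real.norm_eq_abs, abs_le']
    refine ⟨hle f, ?_⟩
    have := hle (-f)
    simpa using this
  have hArange : A ⊆ Set.range (NormedSpace.inclusionInDoubleDualWeak ℝ X) := by
    intro φ hφ
    let T : StrongDual ℝ X →ₗ[ℝ] CompactlySupportedContinuousMap κ ℝ :=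
      { toFun := fun f => ⟨⟨fun k => f (ι k), hι f⟩, HasCompactSupport.of_compactSpace _⟩
        map_add' := fun f g => rfl
        map_smul' := fun c f => rfl }
    obtain ⟨ν, hν, hφν⟩ := exists_measure_integral_eq_of_le T φ.toStrongDual.toLinearMap hφ
    obtain ⟨x, hx⟩ := mem_range_inclusionInDoubleDual_of_forall_finite φ.toStrongDual fun ε hε => by
      classical
      obtain ⟨F, hF⟩ := exists_finset_integral_le ι hι hM ν hε
      refine ⟨F.image ι, fun f hf hf0 => (hφν f).trans_le (hF f hf fun k hk => ?_)⟩
      exact hf0 _ (Finset.mem_image_of_mem ι hk)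
    exact ⟨toWeakSpace ℝ X x, DFunLike.ext _ _ fun f => DFunLike.congr_fun hx f⟩
  have hcomp := (NormedSpace.isEmbedding_inclusionInDoubleDualWeak ℝ X).isCompact_preimage'
    (WeakDual.isCompact_of_bounded_of_closed hAbdd hAclosed) hArange
  refine ⟨{x | ∀ (f : StrongDual ℝ X) (c : ℝ), (∀ k, f (ι k) ≤ c) → f x ≤ c}, ?_, ?_, ?_⟩
  · rw [WeaklyCompact, LinearEquiv.image_eq_preimage_symm]
    exact hcomp
  · simp only [Set.ofPred_forall]
    exact convex_iInter fun f => convex_iInter fun c => convex_iInter fun _ =>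
      convex_halfSpace_le f.isLinear c
  · intro x hx f c hc
    obtain ⟨k, rfl⟩ := hιK x hx
    exact hc k

/-- For a bounded subset `S` of a real Banach space, the De Blasi measure
of weak noncompactness of the convex hull of `S` equals that of `S`. -/
theorem deBlasi_convexHull_eq {X : Type*} [NormedAddCommGroup X] [NormedSpace ℝ X]
    [CompleteSpace X] (S : Set X) (hS : Bornology.IsBounded S) :
    deBlasi (convexHull ℝ S) = deBlasi S := by
  unfold deBlasi
  congr 1
  ext r
  refine and_congr_right fun _ => ⟨?_, ?_⟩
  · rintro ⟨K, hK, hSK⟩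
    exact ⟨K, hK, (subset_convexHull ℝ S).trans hSK⟩
  · rintro ⟨K, hK, hSK⟩
    obtain ⟨L, hL, hconv, hKL⟩ := hK.exists_convex_superset
    exact ⟨L, hL, convexHull_min (hSK.trans (Set.add_subset_add_right hKL))
      (hconv.add (convex_closedBall 0 r))⟩
end

section
/- Let X be a real Banach space, let S be a nonempty, closed and convex subset of X, and let T : S → S be a weakly sequentially continuous mapping such that T(S) is relatively weakly compact. Then T has a fixed point in S. -/
open Filter Topology Pointwise

variable {X : Type*} [NormedAddCommGroup X] [NormedSpace ℝ X]

section Scarf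
variable {V I W : Type*} [LinearOrder W]

/-- A set `U` is dominating for a family of orders if no point lies strictly above the minimum of
`U` in every order. -/
def Dominating (r : I → V → W) (U : Finset V) : Prop :=
  ∀ y, ∃ i, ∀ x ∈ U, r i y ≤ r i x

theorem Dominating.mono {r : I → V → W} {U D : Finset V} (hU : Dominating r U) (h : D ⊆ U) :
    Dominating r D := fun y =>
  let ⟨i, hi⟩ := hU y
  ⟨i, fun x hx => hi x (h hx)⟩

variable [Fintype V] [Fintype I] [DecidableEq V] [DecidableEq I]

open Classical in
theorem Dominating.card_extensions_eq_two {r : I → V → W} (hr : ∀ i, Function.Injective (r i))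
    {D : Finset V} (hD : Dominating r D) (hcard : D.card + 1 = Fintype.card I) (hne : D.Nonempty)
    (hM : ∀ k, ∃ y, ∀ l, l ≠ k → ∃ x ∈ D, r l x < r l y) :
    (Finset.univ.filter fun y => y ∉ D ∧ Dominating r (insert y D)).card = 2 := by
  choose m hmD hm using fun i => D.exists_min_image (r i) hne
  have hsurj : ∀ x ∈ D, ∃ i, m i = x := fun x hx => by
    obtain ⟨i, hi⟩ := hD x
    exact ⟨i, hr i (le_antisymm (hm i x hx) (hi _ (hmD i)))⟩
  obtain ⟨i, -, j, -, hij, hmij⟩ := Finset.exists_ne_map_eq_of_card_lt_of_maps_to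
    (s := Finset.univ) (t := D) (by rw [Finset.card_univ]; omega) (f := m) (fun i _ => hmD i)
  have hinj : ∀ k, (∀ x ∈ D, ∃ l, l ≠ k ∧ m l = x) →
      ∀ a b, a ≠ k → b ≠ k → m a = m b → a = b := by
    intro k hk a b ha hb hab
    refine Finset.injOn_of_surjOn_of_card_le (s := Finset.univ.erase k) (t := D) m
      (fun l _ => hmD l) ?_ ?_ (by simpa using ha) (by simpa using hb) hab
    · intro x hx
      obtain ⟨l, hl, rfl⟩ := hk x hx
      exact ⟨l, by simpa using hl, rfl⟩
    · rw [Finset.card_erase_of_mem (Finset.mem_univ k), Finset.card_univ]; omega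
  have hM' : ∀ k, ∃ y, (∀ l, l ≠ k → r l (m l) < r l y) ∧
      ∀ z, (∀ l, l ≠ k → r l (m l) < r l z) → r k z ≤ r k y := by
    intro k
    obtain ⟨y, hy⟩ := hM k
    have hne : (Finset.univ.filter fun y => ∀ l, l ≠ k → r l (m l) < r l y).Nonempty := by
      refine ⟨y, ?_⟩
      simp only [Finset.mem_filter, Finset.mem_univ, true_and]
      intro l hl
      obtain ⟨x, hx, hxy⟩ := hy l hl
      exact (hm l x hx).trans_lt hxy
    obtain ⟨z, hz, hmax⟩ := Finset.exists_max_image _ (r k) hne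
    simp only [Finset.mem_filter, Finset.mem_univ, true_and] at hz hmax
    exact ⟨z, hz, hmax⟩
  choose g hg hgmax using hM'
  have hcover : ∀ k, k = i ∨ k = j → ∀ x ∈ D, ∃ l, l ≠ k ∧ m l = x := by
    intro k hk x hx
    obtain ⟨l, rfl⟩ := hsurj x hx
    grind
  have hsub : ∀ k, k = i ∨ k = j → g k ∉ D ∧ Dominating r (insert (g k) D) := by
    intro k hk
    constructor
    · intro hmem
      obtain ⟨l, hl, hl'⟩ := hcover k hk _ hmem
      exact absurd (hg k l hl) (by rw [hl']; exact lt_irrefl _)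
    · intro z
      by_cases hz : ∀ l, l ≠ k → r l (m l) < r l z
      · obtain ⟨l, hl⟩ := hD z
        have hlk : l = k := by
          by_contra h
          exact absurd (hz l h) (not_lt.2 (hl _ (hmD l)))
        subst hlk
        refine ⟨l, fun x hx => ?_⟩
        rcases Finset.mem_insert.1 hx with rfl | hx
        · exact hgmax l z hz
        · exact hl x hx
      · push Not at hz
        obtain ⟨l, hl, hzl⟩ := hz
        refine ⟨l, fun x hx => ?_⟩
        rcases Finset.mem_insert.1 hx with rfl | hx
        · exact hzl.trans (hg k l hl).le
        · exact hzl.trans (hm l x hx)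
  have hne' : g i ≠ g j := by
    intro h
    obtain ⟨l, hl⟩ := hD (g i)
    have := hl _ (hmD l)
    by_cases hli : l = i
    · have := hg j l (by grind)
      grind
    · have := hg i l hli
      grind
  rw [← Finset.card_pair hne']
  congr 1
  ext y
  simp only [Finset.mem_filter, Finset.mem_univ, true_and, Finset.mem_insert,
    Finset.mem_singleton]
  constructor
  · rintro ⟨hyD, hy⟩
    obtain ⟨k, hk⟩ := hy y
    have hcov : ∀ x ∈ D, ∃ l, (l ≠ k ∧ m l = x) ∧ r l x ≤ r l y := by
      intro x hx
      obtain ⟨l, hl⟩ := hy x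
      refine ⟨l, ⟨?_, hr l (le_antisymm (hm l x hx) (hl _ (Finset.mem_insert_of_mem (hmD l))))⟩,
        hl y (Finset.mem_insert_self _ _)⟩
      rintro rfl
      have h1 := hl y (Finset.mem_insert_self _ _)
      have h2 := hk x (Finset.mem_insert_of_mem hx)
      exact hyD (hr l (le_antisymm h1 h2) ▸ hx)
    have hkinj := hinj k fun x hx => (hcov x hx).imp fun l hl => hl.1
    have hkij : k = i ∨ k = j := by
      by_contra! h
      exact hij (hkinj i j h.1.symm h.2.symm hmij)
    have hyM : ∀ l, l ≠ k → r l (m l) < r l y := by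
      intro l hl
      obtain ⟨l', ⟨hl', hml⟩, hle⟩ := hcov (m l) (hmD l)
      obtain rfl := hkinj l' l hl' hl hml
      exact lt_of_le_of_ne hle fun h => hyD (hr _ h ▸ hmD _)
    have : y = g k := by
      refine hr k (le_antisymm (hgmax k y hyM) ?_)
      obtain ⟨l, hl⟩ := hy (g k)
      have hlk : l = k := by
        by_contra h
        exact absurd (hg k l h) (not_lt.2 (hl _ (Finset.mem_insert_of_mem (hmD l))))
      subst hlk
      exact hl y (Finset.mem_insert_self _ _)
    rcases hkij with rfl | rfl
    · exact Or.inl this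
    · exact Or.inr this
  · rintro (rfl | rfl)
    · exact hsub i (Or.inl rfl)
    · exact hsub j (Or.inr rfl)


omit [Fintype I] [DecidableEq I] in
open Classical in
theorem Dominating.card_supersets_eq (r : I → V → W) (D : Finset V) {n : ℕ} (hn : D.card + 1 = n) :
    (Finset.univ.filter fun U => (Dominating r U ∧ U.card = n) ∧ D ⊆ U).card =
      (Finset.univ.filter fun y => y ∉ D ∧ Dominating r (insert y D)).card := by
  symm
  refine Finset.card_bij (fun y _ => insert y D) ?_ ?_ ?_
  · intro y hy
    simp only [Finset.mem_filter, Finset.mem_univ, true_and] at hy ⊢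
    exact ⟨⟨hy.2, by rw [Finset.card_insert_of_notMem hy.1, hn]⟩, Finset.subset_insert _ _⟩
  · intro y hy z hz h
    simp only [Finset.mem_filter, Finset.mem_univ, true_and] at hy hz
    have : y ∈ insert z D := h ▸ Finset.mem_insert_self y D
    grind
  · intro U hU
    simp only [Finset.mem_filter, Finset.mem_univ, true_and] at hU
    obtain ⟨y, hy, rfl⟩ := Finset.exists_eq_insert_iff.2 ⟨hU.2, by omega⟩
    exact ⟨y, by simp [hy, hU.1.1], rfl⟩

omit [Fintype V] in
open Classical in
theorem even_card_erase_image_eq {c : V → I} {i₀ : I} {U : Finset V}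
    (hU : U.card = Fintype.card I) (hc : U.image c ≠ Finset.univ) :
    Even (U.powerset.filter fun D => D.card + 1 = Fintype.card I ∧
      D.image c = Finset.univ.erase i₀).card := by
  have hcardI : (Finset.univ.erase i₀).card + 1 = Fintype.card I := by
    rw [Finset.card_erase_add_one (Finset.mem_univ _), Finset.card_univ]
  rcases (U.powerset.filter fun D => D.card + 1 = Fintype.card I ∧
      D.image c = Finset.univ.erase i₀).eq_empty_or_nonempty with h | ⟨D, hD⟩
  · rw [h]; simp
  simp only [Finset.mem_filter, Finset.mem_powerset] at hD
  obtain ⟨hDU, hDc, hDi⟩ := hD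
  obtain ⟨x, hx, rfl⟩ := Finset.exists_eq_insert_iff.2 ⟨hDU, by omega⟩
  have hinj : Set.InjOn c D := Finset.card_image_iff.1 (by rw [hDi]; omega)
  have hxi : c x ≠ i₀ := by
    intro h
    apply hc
    rw [Finset.image_insert, hDi, h, Finset.insert_erase (Finset.mem_univ _)]
  obtain ⟨x', hx', hxx'⟩ : ∃ x' ∈ D, c x' = c x := by
    have : c x ∈ D.image c := by rw [hDi]; simp [hxi]
    simpa using this
  have hne : x ≠ x' := fun h => hx (h ▸ hx')
  have hpair : (insert x D).powerset.filter (fun D => D.card + 1 = Fintype.card I ∧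
      D.image c = Finset.univ.erase i₀) = {D, (insert x D).erase x'} := by
    ext E
    simp only [Finset.mem_filter, Finset.mem_powerset, Finset.mem_insert, Finset.mem_singleton]
    constructor
    · rintro ⟨hE, hEc, hEi⟩
      obtain ⟨z, hz, hzE⟩ := Finset.exists_eq_insert_iff.2 ⟨hE, by omega⟩
      have hEinj : Set.InjOn c E := Finset.card_image_iff.1 (by rw [hEi]; omega)
      have hEz : E = (insert x D).erase z := by rw [← hzE, Finset.erase_insert hz]
      have : z = x ∨ z = x' := by
        by_contra! h
        refine hne (hEinj ?_ ?_ hxx'.symm)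
        · rw [hEz]; simp [h.1.symm]
        · rw [hEz]; simp [h.2.symm, hx']
      rcases this with rfl | rfl
      · left; rw [hEz, Finset.erase_insert hx]
      · right; exact hEz
    · rintro (rfl | rfl)
      · exact ⟨Finset.subset_insert _ _, hDc, hDi⟩
      · refine ⟨Finset.erase_subset _ _, ?_, ?_⟩
        · rw [Finset.card_erase_add_one (Finset.mem_insert_of_mem hx'), hU]
        · rw [← hDi]
          ext i
          simp only [Finset.mem_image, Finset.mem_erase, Finset.mem_insert]
          constructor
          · rintro ⟨a, ⟨ha, rfl | ha'⟩, rfl⟩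
            · exact ⟨x', hx', hxx'⟩
            · exact ⟨a, ha', rfl⟩
          · rintro ⟨a, ha, rfl⟩
            by_cases h : a = x'
            · exact ⟨x, ⟨hne, Or.inl rfl⟩, by rw [h, hxx']⟩
            · exact ⟨a, ⟨h, Or.inr ha⟩, rfl⟩
  rw [hpair, Finset.card_pair]
  · exact even_two
  · intro h
    have : x' ∈ (insert x D).erase x' := h ▸ hx'
    simp at this

/-- **Scarf's lemma**: for linear orders indexed by `I` on a finite set with slack points `s i`
(the least point in the order `i`, above all ordinary points in the others) and a coloring giving
`s i` the color `i`, some dominating set of size `card I` carries all colors. -/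
theorem exists_dominating_image_eq_univ [Nonempty I] {r : I → V → W}
    (hr : ∀ i, Function.Injective (r i)) {s : I → V} (hs : Function.Injective s)
    (hlow : ∀ i v, r i (s i) ≤ r i v)
    (hhigh : ∀ i j v, j ≠ i → v ∉ Set.range s → r i v < r i (s j))
    (hT : ∃ v, v ∉ Set.range s) {c : V → I} (hc : ∀ i, c (s i) = i) :
    ∃ U : Finset V, Dominating r U ∧ U.card = Fintype.card I ∧ U.image c = Finset.univ := by
  classical
  by_contra! hcon
  obtain ⟨i₀⟩ := ‹Nonempty I›
  have hcardI : (Finset.univ.erase i₀).card + 1 = Fintype.card I := by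
    rw [Finset.card_erase_add_one (Finset.mem_univ _), Finset.card_univ]
  set rooms : Finset (Finset V) :=
    Finset.univ.filter fun U => Dominating r U ∧ U.card = Fintype.card I with hrooms
  set doors : Finset (Finset V) := Finset.univ.filter fun D =>
    D.card + 1 = Fintype.card I ∧ D.image c = Finset.univ.erase i₀ with hdoors
  have key := Finset.sum_card_bipartiteAbove_eq_sum_card_bipartiteBelow (s := rooms) (t := doors)
    (fun U D => D ⊆ U)
  have hleft : Even (∑ U ∈ rooms, (doors.bipartiteAbove (fun U D => D ⊆ U) U).card) := by
    refine Finset.even_sum _ fun U hU => ?_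
    simp only [hrooms, Finset.mem_filter, Finset.mem_univ, true_and] at hU
    have heq : doors.bipartiteAbove (fun U D => D ⊆ U) U = U.powerset.filter fun D =>
        D.card + 1 = Fintype.card I ∧ D.image c = Finset.univ.erase i₀ := by
      ext D
      simp [hdoors, Finset.bipartiteAbove, and_comm]
    rw [heq]
    exact even_card_erase_image_eq hU.2 (hcon U hU.1 hU.2)
  have hbelow : ∀ D ∈ doors, (rooms.bipartiteBelow (fun U D => D ⊆ U) D).card =
      (Finset.univ.filter fun y => y ∉ D ∧ Dominating r (insert y D)).card := by
    intro D hD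
    simp only [hdoors, Finset.mem_filter, Finset.mem_univ, true_and] at hD
    rw [← Dominating.card_supersets_eq r D hD.1]
    congr 1
    ext U
    simp [hrooms, Finset.bipartiteBelow]
  set D₀ : Finset V := (Finset.univ.erase i₀).image s with hD₀
  have hD₀mem : D₀ ∈ doors := by
    simp only [hdoors, Finset.mem_filter, Finset.mem_univ, true_and, hD₀]
    refine ⟨by rw [Finset.card_image_of_injective _ hs, hcardI], ?_⟩
    rw [Finset.image_image, show c ∘ s = id from funext hc, Finset.image_id]
  have hother : ∀ D ∈ doors.erase D₀,
      Even (rooms.bipartiteBelow (fun U D => D ⊆ U) D).card := by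
    intro D hD
    obtain ⟨hne, hD⟩ := Finset.mem_erase.1 hD
    rw [hbelow D hD]
    simp only [hdoors, Finset.mem_filter, Finset.mem_univ, true_and] at hD
    by_cases hdom : Dominating r D
    · obtain ⟨v, hvD, hv⟩ : ∃ v ∈ D, v ∉ Set.range s := by
        by_contra! h
        refine hne (Finset.eq_of_subset_of_card_le ?_ ?_)
        · intro x hx
          obtain ⟨i, rfl⟩ := h x hx
          have : c (s i) ∈ Finset.univ.erase i₀ := hD.2 ▸ Finset.mem_image_of_mem c hx
          rw [hc] at this
          exact Finset.mem_image_of_mem s this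
        · rw [hD₀, Finset.card_image_of_injective _ hs]; omega
      rw [hdom.card_extensions_eq_two hr hD.1 ⟨v, hvD⟩]
      · exact even_two
      · intro k
        refine ⟨s k, fun l hl => ⟨v, hvD, hhigh l k v hl.symm hv⟩⟩
    · rw [Finset.filter_false_of_mem]
      · simp
      · exact fun y _ h => hdom (h.2.mono (Finset.subset_insert _ _))
  have hone : (rooms.bipartiteBelow (fun U D => D ⊆ U) D₀).card = 1 := by
    rw [hbelow D₀ hD₀mem, Finset.card_eq_one]
    obtain ⟨v, hv⟩ := hT
    obtain ⟨w, hw, hmax⟩ := Finset.exists_max_image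
      (Finset.univ.filter fun v => v ∉ Set.range s) (r i₀) ⟨v, by simpa using hv⟩
    simp only [Finset.mem_filter, Finset.mem_univ, true_and] at hw hmax
    have hD₀i : ∀ i, i ≠ i₀ → s i ∈ D₀ := fun i hi =>
      Finset.mem_image_of_mem s (by simpa using hi)
    have hlt : ∀ i v, v ∉ Set.range s → r i (s i) < r i v := fun i v hv =>
      lt_of_le_of_ne (hlow i v) fun h => hv ⟨i, hr i h⟩
    refine ⟨w, ?_⟩
    ext y
    simp only [Finset.mem_filter, Finset.mem_univ, true_and, Finset.mem_singleton]
    constructor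
    · rintro ⟨hy, hdom⟩
      have hi : ∀ z, z ∉ Set.range s → r i₀ z ≤ r i₀ y := by
        intro z hz
        obtain ⟨i, hi⟩ := hdom z
        have : i = i₀ := by
          by_contra h
          exact absurd (hi _ (Finset.mem_insert_of_mem (hD₀i i h))) (not_le.2 (hlt i z hz))
        subst this
        exact hi y (Finset.mem_insert_self _ _)
      have hys : y ∉ Set.range s := by
        rintro ⟨j, rfl⟩
        by_cases hj : j = i₀
        · subst hj
          exact absurd (hi v hv) (not_le.2 (hlt _ v hv))
        · exact hy (hD₀i j hj)
      exact hr i₀ (le_antisymm (hmax y hys) (hi w hw))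
    · rintro rfl
      refine ⟨fun h => ?_, fun z => ?_⟩
      · obtain ⟨i, -, hi⟩ := Finset.mem_image.1 h
        exact hw ⟨i, hi⟩
      · by_cases hz : z ∈ Set.range s
        · obtain ⟨i, rfl⟩ := hz
          exact ⟨i, fun x _ => hlow i x⟩
        · refine ⟨i₀, fun x hx => ?_⟩
          rcases Finset.mem_insert.1 hx with rfl | hx
          · exact hmax z hz
          · obtain ⟨i, hi, rfl⟩ := Finset.mem_image.1 hx
            exact (hhigh i₀ i z (by simpa using hi) hz).le
  rw [key, ← Finset.add_sum_erase _ _ hD₀mem, hone] at hleft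
  have := Finset.even_sum _ hother
  grind

end Scarf

section Brouwer
variable {I : Type*} [Fintype I] [Nonempty I]

theorem exists_le_apply_of_mem_stdSimplex {x y : I → ℝ} (hx : x ∈ stdSimplex ℝ I)
    (hy : y ∈ stdSimplex ℝ I) : ∃ i, x i ≤ y i := by
  by_contra! h
  have := Finset.sum_lt_sum_of_nonempty (s := Finset.univ) Finset.univ_nonempty
    (fun i _ => h i)
  rw [hx.2, hy.2] at this
  exact lt_irrefl _ this

theorem exists_approx_fixedPoint_stdSimplex {f : (I → ℝ) → I → ℝ}
    (hmaps : Set.MapsTo f (stdSimplex ℝ I) (stdSimplex ℝ I)) {N : ℕ} (hN : 0 < N) :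
    ∃ x ∈ stdSimplex ℝ I, ∀ i, ∃ x' ∈ stdSimplex ℝ I,
      dist x' x ≤ Fintype.card I / N ∧ x' i ≤ f x' i + Fintype.card I / N := by
  classical
  have hN' : (0 : ℝ) < N := by exact_mod_cast hN
  let P := {p : I → Fin (N + 1) // ∑ i, ((p i : ℕ) : ℤ) = N}
  have hP : ∀ q : I → ℤ, (∀ i, 0 ≤ q i) → ∑ i, q i = N → ∃ p : P, ∀ i, ((p.1 i : ℕ) : ℤ) = q i := by
    intro q hq hsum
    have hle : ∀ i, q i ≤ N := fun i => hsum ▸ Finset.single_le_sum (fun j _ => hq j)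
      (Finset.mem_univ i)
    refine ⟨⟨fun i => ⟨(q i).toNat, by have := hq i; have := hle i; omega⟩, ?_⟩, fun i => ?_⟩
    · exact (Finset.sum_congr rfl fun i _ => by simp [hq i]).trans hsum
    · simp [hq i]
  let pt : P → I → ℝ := fun p i => ((p.1 i : ℕ) : ℝ) / N
  have hpt : ∀ p, pt p ∈ stdSimplex ℝ I := by
    intro p
    refine ⟨fun i => by positivity, ?_⟩
    have h : ∑ i, ((p.1 i : ℕ) : ℝ) = N := by exact_mod_cast p.2
    simp only [pt]
    rw [← Finset.sum_div, h, div_self hN'.ne']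
  choose col hcol using fun p => exists_le_apply_of_mem_stdSimplex (hpt p) (hmaps (hpt p))
  let a : I → P ⊕ I → ℤ := fun i => Sum.elim (fun p => ((p.1 i : ℕ) : ℤ))
    fun j => if j = i then -1 else N + 1
  let e := Fintype.equivFin (P ⊕ I)
  let r : I → P ⊕ I → ℤ ×ₗ Fin (Fintype.card (P ⊕ I)) := fun i v => toLex (a i v, e v)
  have hra : ∀ i u v, r i u ≤ r i v → a i u ≤ a i v := by
    intro i u v h
    rcases Prod.Lex.toLex_le_toLex.1 h with h | h
    · exact h.le
    · exact h.1.le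
  have har : ∀ i u v, a i u < a i v → r i u < r i v := fun i u v h =>
    Prod.Lex.toLex_lt_toLex.2 (Or.inl h)
  have hanonneg : ∀ i v, v ≠ Sum.inr i → 0 ≤ a i v := by
    rintro i (p | j) h
    · simp [a]
    · have : j ≠ i := fun h' => h (h' ▸ rfl)
      simp only [a, Sum.elim_inr, if_neg this]; omega
  have hainr : ∀ i, a i (Sum.inr i) = -1 := fun i => by simp [a]
  have k : I := Classical.arbitrary I
  obtain ⟨p₀, -⟩ := hP (Pi.single k (N : ℤ)) (fun i => by
    by_cases h : i = k
    · subst h; simp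
    · simp [h]) (by simp)
  obtain ⟨U, hdom, hcard, himg⟩ := exists_dominating_image_eq_univ (r := r) (s := Sum.inr)
    (c := Sum.elim col id)
    (fun i u v h => by
      have := congrArg (fun w => (ofLex w).2) h
      exact e.injective this)
    Sum.inr_injective
    (fun i v => by
      by_cases h : v = Sum.inr i
      · rw [h]
      · exact (har i _ _ (by rw [hainr]; have := hanonneg i v h; omega)).le)
    (by
      rintro i j (p | l) hj hv
      · refine har _ _ _ ?_
        have := (p.1 i).2
        simp only [a, Sum.elim_inr, Sum.elim_inl, if_neg hj]
        omega
      · exact absurd ⟨l, rfl⟩ hv)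
    ⟨Sum.inl p₀, by simp⟩ (fun i => rfl)
  have hUne : U.Nonempty := Finset.card_pos.1 (hcard ▸ Fintype.card_pos)
  choose m hmU hm using fun i => U.exists_min_image (a i) hUne
  have hbinr : ∀ i, Sum.inr i ∈ U → a i (m i) ≤ -1 := fun i hi => hainr i ▸ hm i _ hi
  have hbge : ∀ i, -1 ≤ a i (m i) := by
    intro i
    by_cases h : m i = Sum.inr i
    · rw [h, hainr]
    · have := hanonneg i _ h; omega
  have hsum : (N : ℤ) < ∑ i, (a i (m i) + 1) := by
    by_contra! h
    obtain ⟨p, hp⟩ := hP (fun i => (a i (m i) + 1) +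
        (Pi.single k ((N : ℤ) - ∑ i, (a i (m i) + 1)) : I → ℤ) i)
      (fun i => by
        have := hbge i
        by_cases hi : i = k
        · subst hi; simp only [Pi.single_eq_same]; omega
        · simp only [Pi.single_eq_of_ne hi]; omega)
      (by rw [Finset.sum_add_distrib, Finset.sum_pi_single']; simp)
    obtain ⟨i, hi⟩ := hdom (Sum.inl p)
    have h1 := hra _ _ _ (hi _ (hmU i))
    have h2 : a i (Sum.inl p) = _ := hp i
    rw [h2] at h1
    by_cases hik : i = k
    · subst hik; simp only [Pi.single_eq_same] at h1; omega
    · simp only [Pi.single_eq_of_ne hik] at h1; omega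
  have hcolor : ∀ i, Sum.inr i ∉ U → ∃ p : P, Sum.inl p ∈ U ∧ col p = i := by
    intro i hi
    have : i ∈ U.image (Sum.elim col id) := himg ▸ Finset.mem_univ i
    obtain ⟨p | j, hv, hvi⟩ := Finset.mem_image.1 this
    · exact ⟨p, hv, hvi⟩
    · exact absurd (show j = i from hvi) (fun h => hi (h ▸ hv))
  have hbound : ∀ p : P, Sum.inl p ∈ U → ∀ i, a i (m i) ≤ ((p.1 i : ℕ) : ℤ) ∧
      ((p.1 i : ℕ) : ℤ) < a i (m i) + Fintype.card I := by
    intro p hp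
    have hle : ∀ i, a i (m i) ≤ ((p.1 i : ℕ) : ℤ) := fun i => hm i _ hp
    refine fun i => ⟨hle i, ?_⟩
    have h1 := Finset.single_le_sum (f := fun j => ((p.1 j : ℕ) : ℤ) - a j (m j))
      (fun j _ => sub_nonneg.2 (hle j)) (Finset.mem_univ i)
    rw [Finset.sum_sub_distrib, p.2] at h1
    rw [Finset.sum_add_distrib] at hsum
    simp only [Finset.sum_const, Finset.card_univ, nsmul_eq_mul, mul_one] at hsum
    linarith
  obtain ⟨i₁, hi₁⟩ : ∃ i, Sum.inr i ∉ U := by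
    by_contra! h
    have : ∑ i, (a i (m i) + 1) ≤ 0 := Finset.sum_nonpos fun i _ => by
      have := hbinr i (h i); omega
    omega
  obtain ⟨p, hpU, -⟩ := hcolor i₁ hi₁
  refine ⟨pt p, hpt p, fun i => ?_⟩
  by_cases hi : Sum.inr i ∈ U
  · refine ⟨pt p, hpt p, by rw [dist_self]; positivity, ?_⟩
    have h1 : ((p.1 i : ℕ) : ℤ) ≤ Fintype.card I := by
      have := (hbound p hpU i).2
      have := hbinr i hi
      omega
    have h2 : ((p.1 i : ℕ) : ℝ) ≤ Fintype.card I := by exact_mod_cast h1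
    have h3 : pt p i ≤ Fintype.card I / N := by simp only [pt]; gcongr
    have := (hmaps (hpt p)).1 i
    linarith
  · obtain ⟨q, hqU, rfl⟩ := hcolor i hi
    refine ⟨pt q, hpt q, ?_, ?_⟩
    · rw [dist_pi_le_iff (by positivity)]
      intro j
      have h1 := hbound p hpU j
      have h2 := hbound q hqU j
      have h3 : |((q.1 j : ℕ) : ℤ) - ((p.1 j : ℕ) : ℤ)| ≤ Fintype.card I := by
        rw [abs_le]; constructor <;> omega
      have h4 : |((q.1 j : ℕ) : ℝ) - ((p.1 j : ℕ) : ℝ)| ≤ Fintype.card I := by exact_mod_cast h3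
      simp only [pt]
      rw [Real.dist_eq, ← sub_div, abs_div, abs_of_pos hN']
      gcongr
    · have := hcol q
      have : (0 : ℝ) ≤ Fintype.card I / N := by positivity
      linarith

/-- **Brouwer's fixed point theorem** for the standard simplex. -/
theorem exists_fixedPoint_stdSimplex {f : (I → ℝ) → I → ℝ}
    (hf : ContinuousOn f (stdSimplex ℝ I))
    (hmaps : Set.MapsTo f (stdSimplex ℝ I) (stdSimplex ℝ I)) :
    ∃ x ∈ stdSimplex ℝ I, f x = x := by
  choose x hx x' hx' hdist hle using fun n : ℕ =>
    exists_approx_fixedPoint_stdSimplex hmaps n.succ_pos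
  obtain ⟨z, hz, φ, hφ, hlim⟩ := (isCompact_stdSimplex ℝ I).tendsto_subseq hx
  have hsmall : Tendsto (fun n : ℕ => (Fintype.card I : ℝ) / ((φ n).succ : ℕ)) atTop (𝓝 0) :=
    (tendsto_const_div_atTop_nhds_zero_nat _).comp
      ((tendsto_add_atTop_nat 1).comp hφ.tendsto_atTop)
  have hle' : ∀ i, z i ≤ f z i := by
    intro i
    have hlim' : Tendsto (fun n => x' (φ n) i) atTop (𝓝 z) := by
      refine hlim.congr_dist ?_
      refine squeeze_zero (fun _ => dist_nonneg) (fun n => ?_) hsmall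
      rw [dist_comm]
      exact hdist (φ n) i
    have hflim : Tendsto (fun n => f (x' (φ n) i)) atTop (𝓝 (f z)) :=
      (hf z hz).tendsto.comp (tendsto_nhdsWithin_iff.2
        ⟨hlim', Eventually.of_forall fun n => hx' (φ n) i⟩)
    have h1 := (tendsto_pi_nhds.1 hlim') i
    have h2 := ((tendsto_pi_nhds.1 hflim) i).add hsmall
    rw [add_zero] at h2
    exact le_of_tendsto_of_tendsto' h1 h2 fun n => hle (φ n) i
  refine ⟨z, hz, funext fun i => ?_⟩
  have := (Finset.sum_eq_sum_iff_of_le (s := Finset.univ) fun i _ => hle' i).1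
    (by rw [hz.2, (hmaps hz).2])
  exact (this i (Finset.mem_univ i)).symm

end Brouwer

section Schauder
variable {E : Type*} [NormedAddCommGroup E] [NormedSpace ℝ E]

theorem exists_approx_fixedPoint_of_compact {K : Type*} [MetricSpace K] [CompactSpace K]
    {D : Set E} (hne : D.Nonempty) (hD : Convex ℝ D) {j : K → E} (hj : ∀ k, j k ∈ D) {τ : E → K}
    (hτ : ContinuousOn τ D) {ε : ℝ} (hε : 0 < ε) :
    ∃ x ∈ D, ∀ (f : E →L[ℝ] ℝ) (η : ℝ), (∀ y z : K, dist y z < ε → |f (j y) - f (j z)| ≤ η) →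
      |f x - f (j (τ x))| ≤ η := by
  obtain ⟨t, -, htfin, ht⟩ := finite_cover_balls_of_compact (isCompact_univ (X := K)) hε
  have hcov : ∀ k : K, ∃ y ∈ t, dist k y < ε := fun k => by
    simpa using ht (Set.mem_univ k)
  have : Fintype t := htfin.fintype
  obtain ⟨x₀, -⟩ := hne
  have : Nonempty t := by
    obtain ⟨y, hy, -⟩ := hcov (τ x₀)
    exact ⟨⟨y, hy⟩⟩
  let w : t → K → ℝ := fun y k => max 0 (ε - dist k y)
  have hwc : ∀ y, Continuous (w y) := fun y => by fun_prop
  have hw0 : ∀ y k, 0 ≤ w y k := fun y k => le_max_left _ _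
  have hW : ∀ k, 0 < ∑ y, w y k := fun k => by
    obtain ⟨y, hy, hky⟩ := hcov k
    exact Finset.sum_pos' (fun y _ => hw0 y k)
      ⟨⟨y, hy⟩, Finset.mem_univ _, lt_max_of_lt_right (sub_pos.2 hky)⟩
  let p : (t → ℝ) → E := fun s => ∑ y, s y • j y
  have hpD : Set.MapsTo p (stdSimplex ℝ t) D := fun s hs =>
    hD.sum_mem (fun y _ => hs.1 y) hs.2 fun y _ => hj y
  have hpc : Continuous p := by fun_prop
  have hτp : ContinuousOn (fun s => τ (p s)) (stdSimplex ℝ t) := hτ.comp hpc.continuousOn hpD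
  obtain ⟨s, hs, hfix⟩ := exists_fixedPoint_stdSimplex (I := t)
    (f := fun s y => w y (τ (p s)) / ∑ z, w z (τ (p s)))
    (continuousOn_pi.2 fun y => ((hwc y).comp_continuousOn hτp).div
      (continuousOn_finsetSum _ fun z _ => (hwc z).comp_continuousOn hτp) fun s _ => (hW _).ne')
    (fun s _ => ⟨fun y => div_nonneg (hw0 _ _) (hW _).le, by
      simp only
      rw [← Finset.sum_div, div_self (hW _).ne']⟩)
  refine ⟨p s, hpD hs, fun f η hη => ?_⟩
  have hdiff : f (p s) - f (j (τ (p s))) = ∑ y, s y * (f (j y) - f (j (τ (p s)))) := by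
    simp only [mul_sub, Finset.sum_sub_distrib, ← Finset.sum_mul, hs.2, one_mul, p, map_sum,
      map_smul, smul_eq_mul]
  rw [hdiff]
  calc _ ≤ ∑ y, |s y * (f (j y) - f (j (τ (p s))))| := Finset.abs_sum_le_sum_abs _ _
    _ ≤ ∑ y, s y * η := by
      refine Finset.sum_le_sum fun y _ => ?_
      rw [abs_mul, abs_of_nonneg (hs.1 y)]
      by_cases hy : dist (y : K) (τ (p s)) < ε
      · exact mul_le_mul_of_nonneg_left (hη _ _ hy) (hs.1 y)
      · have : s y = 0 := by
          rw [← hfix]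
          simp only [w]
          rw [max_eq_left (by rw [dist_comm]; linarith), zero_div]
        simp [this]
    _ = η := by rw [← Finset.sum_mul, hs.2, one_mul]

theorem Convex.mem_of_weakConv {D : Set E} (hD : Convex ℝ D) (hcl : IsClosed D) {u : ℕ → E} {x : E}
    (hu : ∀ n, u n ∈ D) (hux : WeakConv u x) : x ∈ D := by
  by_contra hx
  obtain ⟨f, c, hfx, hfD⟩ := geometric_hahn_banach_point_closed hD hcl hx
  exact absurd (ge_of_tendsto' (hux f) fun n => (hfD _ (hu n)).le) (not_le.2 hfx)

theorem WeakConv.of_tendsto {u : ℕ → E} {x : E} (h : Tendsto u atTop (𝓝 x)) : WeakConv u x :=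
  fun f => (f.continuous.tendsto x).comp h

theorem WeakConv.unique {u : ℕ → E} {x y : E} (hx : WeakConv u x) (hy : WeakConv u y) : x = y :=
  (SeparatingDual.eq_iff_forall_dual_eq (R := ℝ)).2 fun f => tendsto_nhds_unique (hx f) (hy f)

theorem IsSeparable.image_of_weakConv {S D : Set E} {T : E → E}
    (hT : ∀ (u : ℕ → E) (x : E), (∀ n, u n ∈ S) → x ∈ S →
      WeakConv u x → WeakConv (fun n => T (u n)) (T x))
    (hD : TopologicalSpace.IsSeparable D) (hDS : D ⊆ S) :
    TopologicalSpace.IsSeparable (T '' D) := by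
  obtain ⟨c, hcD, hc, hDc⟩ := hD.exists_countable_dense_subset
  have hsep : TopologicalSpace.IsSeparable
      (closure (Submodule.span ℝ (T '' c) : Set E)) :=
    ((hc.image T).isSeparable.span (R := ℝ)).closure
  refine hsep.mono ?_
  rintro _ ⟨x, hx, rfl⟩
  obtain ⟨u, hu, hux⟩ := mem_closure_iff_seq_limit.1 (hDc hx)
  refine (Submodule.span ℝ (T '' c)).convex.closure.mem_of_weakConv isClosed_closure
    (u := fun n => T (u n)) (fun n => subset_closure (Submodule.subset_span ⟨_, hu n, rfl⟩)) ?_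
  exact hT u x (fun n => hDS (hcD (hu n))) (hDS hx) (.of_tendsto hux)

theorem exists_separable_invariant_subset {S : Set E} (hne : S.Nonempty) (hcl : IsClosed S)
    (hconv : Convex ℝ S) {T : E → E} (hmaps : Set.MapsTo T S S)
    (hT : ∀ (u : ℕ → E) (x : E), (∀ n, u n ∈ S) → x ∈ S →
      WeakConv u x → WeakConv (fun n => T (u n)) (T x)) :
    ∃ D ⊆ S, D.Nonempty ∧ IsClosed D ∧ Convex ℝ D ∧ TopologicalSpace.IsSeparable D ∧
      Set.MapsTo T D D := by
  obtain ⟨x₀, hx₀⟩ := hne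
  let F : Set E → Set E := fun A => convexHull ℝ (A ∪ T '' A)
  let A : ℕ → Set E := fun n => F^[n] {x₀}
  have hA : ∀ n, A (n + 1) = convexHull ℝ (A n ∪ T '' A n) := fun n =>
    Function.iterate_succ_apply' F n _
  have hAsub : ∀ n, A n ∪ T '' A n ⊆ A (n + 1) := fun n => by
    rw [hA]; exact subset_convexHull ℝ _
  have hAmono : Monotone A := monotone_nat_of_le_succ fun n =>
    Set.subset_union_left.trans (hAsub n)
  have hAS : ∀ n, A n ⊆ S := by
    intro n
    induction n with
    | zero => simpa [A] using hx₀
    | succ n ih =>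
      rw [hA]
      refine convexHull_min (Set.union_subset ih ?_) hconv
      exact (Set.image_mono ih).trans hmaps.image_subset
  have hAsep : ∀ n, TopologicalSpace.IsSeparable (A n) := by
    intro n
    induction n with
    | zero => exact (Set.countable_singleton x₀).isSeparable
    | succ n ih =>
      rw [hA]
      exact ((ih.union (IsSeparable.image_of_weakConv hT ih (hAS n))).span (R := ℝ)).mono
        (convexHull_min Submodule.subset_span (Submodule.convex _))
  have hAconv : ∀ n, Convex ℝ (A n) := by
    rintro (_ | n)
    · exact convex_singleton x₀
    · rw [hA]; exact convex_convexHull ℝ _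
  have hDconv : Convex ℝ (closure (⋃ n, A n)) :=
    (hAmono.directed_le.convex_iUnion hAconv).closure
  have hDS : closure (⋃ n, A n) ⊆ S := closure_minimal (Set.iUnion_subset hAS) hcl
  refine ⟨closure (⋃ n, A n), hDS, ⟨x₀, subset_closure (Set.mem_iUnion.2 ⟨0, rfl⟩)⟩,
    isClosed_closure, hDconv, (TopologicalSpace.IsSeparable.iUnion hAsep).closure, ?_⟩
  intro x hx
  obtain ⟨u, hu, hux⟩ := mem_closure_iff_seq_limit.1 hx
  refine hDconv.mem_of_weakConv isClosed_closure (u := fun n => T (u n)) (fun n => ?_)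
    (hT u x (fun n => hDS (subset_closure (hu n))) (hDS hx) (.of_tendsto hux))
  obtain ⟨k, hk⟩ := Set.mem_iUnion.1 (hu n)
  exact subset_closure (Set.mem_iUnion.2 ⟨k + 1, hAsub k (Or.inr ⟨_, hk, rfl⟩)⟩)

theorem TopologicalSpace.IsSeparable.exists_countable_separating_dual {D : Set E}
    (hD : TopologicalSpace.IsSeparable D) :
    ∃ G : Set (E →L[ℝ] ℝ), G.Countable ∧
      ∀ x ∈ D, ∀ y ∈ D, (∀ g ∈ G, g x = g y) → x = y := by
  obtain ⟨c, hcD, hc, hDc⟩ := hD.exists_countable_dense_subset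
  choose g hg1 hg using fun x : E => exists_dual_vector'' ℝ x
  refine ⟨(fun p : E × E => g (p.1 - p.2)) '' (c ×ˢ c), (hc.prod hc).image _, ?_⟩
  intro x hx y hy h
  by_contra hxy
  have hpos : 0 < ‖x - y‖ / 4 := by have := norm_pos_iff.2 (sub_ne_zero.2 hxy); positivity
  obtain ⟨a, ha, hxa⟩ := Metric.mem_closure_iff.1 (hDc hx) _ hpos
  obtain ⟨b, hb, hyb⟩ := Metric.mem_closure_iff.1 (hDc hy) _ hpos
  have h1 := h _ ⟨(a, b), ⟨ha, hb⟩, rfl⟩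
  simp only at h1
  have h2 : g (a - b) (a - b) = ‖a - b‖ := by simpa using hg (a - b)
  rw [dist_eq_norm] at hxa hyb
  have h3 : g (a - b) ((a - b) - (x - y)) = ‖a - b‖ := by
    rw [map_sub, h2, map_sub, h1, sub_self, sub_zero]
  have h4 : ‖a - b‖ ≤ ‖(a - b) - (x - y)‖ := by
    calc ‖a - b‖ = g (a - b) ((a - b) - (x - y)) := h3.symm
      _ ≤ ‖g (a - b) ((a - b) - (x - y))‖ := le_abs_self _
      _ ≤ 1 * ‖(a - b) - (x - y)‖ := (g (a - b)).le_of_opNorm_le (hg1 _) _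
      _ = _ := one_mul _
  have h5 : ‖(a - b) - (x - y)‖ ≤ ‖x - a‖ + ‖y - b‖ := by
    rw [show (a - b) - (x - y) = (y - b) - (x - a) by abel, add_comm]
    exact norm_sub_le _ _
  have h6 : ‖x - y‖ ≤ ‖a - b‖ + ‖(a - b) - (x - y)‖ := by
    rw [show x - y = (a - b) - ((a - b) - (x - y)) by abel]
    exact (norm_sub_le _ _).trans (by simp)
  linarith

theorem continuous_dual_weakSpace (f : E →L[ℝ] ℝ) :
    Continuous fun x : WeakSpace ℝ E => f ((toWeakSpace ℝ E).symm x) :=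
  WeakBilin.eval_continuous (topDualPairing ℝ E).flip f

theorem WeakConv.tendsto_toWeakSpace {u : ℕ → E} {x : E} (h : WeakConv u x) :
    Tendsto (fun n => toWeakSpace ℝ E (u n)) atTop (𝓝 (toWeakSpace ℝ E x)) := by
  refine (WeakBilin.tendsto_iff_forall_eval_tendsto (topDualPairing ℝ E).flip ?_).2 h
  intro x y hxy
  exact (SeparatingDual.eq_iff_forall_dual_eq (R := ℝ)).2 fun f => LinearMap.congr_fun hxy f

end Schauder

/-- A weakly sequentially continuous self-map of a nonempty closed convex
subset of a real Banach space whose range is relatively weakly compact has a fixed point. -/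
theorem fixedPoint_of_weaklySeqContinuous_relWeaklyCompact {X : Type*}
    [NormedAddCommGroup X] [NormedSpace ℝ X] [CompleteSpace X]
    (S : Set X) (hne : S.Nonempty) (hcl : IsClosed S) (hconv : Convex ℝ S)
    (T : X → X) (hmaps : Set.MapsTo T S S)
    (hwsc : ∀ (u : ℕ → X) (x : X), (∀ n, u n ∈ S) → x ∈ S →
      WeakConv u x → WeakConv (fun n => T (u n)) (T x))
    (hcomp : RelWeaklyCompact (T '' S)) :
    ∃ x ∈ S, T x = x := by
  obtain ⟨D, hDS, hDne, hDcl, hDconv, hDsep, hDT⟩ :=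
    exists_separable_invariant_subset hne hcl hconv hmaps hwsc
  obtain ⟨G, hG, hGsep⟩ := hDsep.exists_countable_separating_dual
  set A : Set (WeakSpace ℝ X) := closure (toWeakSpace ℝ X '' (T '' D)) with hA
  have hAcomp : IsCompact A := by
    have h : IsCompact (closure (toWeakSpace ℝ X '' (T '' S))) := by
      have := hcomp
      rwa [RelWeaklyCompact, WeaklyCompact, weakClosure,
        Set.image_preimage_eq _ (toWeakSpace ℝ X).surjective] at this
    exact h.of_isClosed_subset isClosed_closure
      (closure_mono (Set.image_mono (Set.image_mono hDS)))
  have hAD : ∀ a ∈ A, (toWeakSpace ℝ X).symm a ∈ D := by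
    have hsub : A ⊆ toWeakSpace ℝ X '' D := by
      have h := hDconv.toWeakSpace_closure ℝ
      rw [hDcl.closure_eq] at h
      rw [h]
      exact closure_mono (Set.image_mono hDT.image_subset)
    intro a ha
    obtain ⟨x, hx, rfl⟩ := hsub ha
    simpa using hx
  have : CompactSpace A := isCompact_iff_compactSpace.1 hAcomp
  have : Countable G := hG
  let e : A → G → ℝ := fun a g => (g : X →L[ℝ] ℝ) ((toWeakSpace ℝ X).symm a)
  have hec : Continuous e := continuous_pi fun g =>
    (continuous_dual_weakSpace (g : X →L[ℝ] ℝ)).comp continuous_subtype_val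
  have heinj : Function.Injective e := fun a b hab => Subtype.ext
    ((toWeakSpace ℝ X).symm.injective
      (hGsep _ (hAD a a.2) _ (hAD b b.2) fun g hg => congrFun hab ⟨g, hg⟩))
  have : TopologicalSpace.MetrizableSpace A := (hec.isClosedEmbedding heinj).metrizableSpace
  let metricA : MetricSpace A := TopologicalSpace.metrizableSpaceMetric A
  let j : A → X := fun a => (toWeakSpace ℝ X).symm a
  have hjc : ∀ f : X →L[ℝ] ℝ, Continuous fun a => f (j a) := fun f =>
    (continuous_dual_weakSpace f).comp continuous_subtype_val
  have hTA : ∀ x ∈ D, toWeakSpace ℝ X (T x) ∈ A := fun x hx =>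
    subset_closure ⟨T x, ⟨x, hx, rfl⟩, rfl⟩
  obtain ⟨x₀, hx₀⟩ := hDne
  classical
  let τ : X → A := fun x => if hx : x ∈ D then ⟨toWeakSpace ℝ X (T x), hTA x hx⟩ else
    ⟨toWeakSpace ℝ X (T x₀), hTA x₀ hx₀⟩
  have hjτ : ∀ x ∈ D, j (τ x) = T x := fun x hx => by
    simp only [j, τ, dif_pos hx, LinearEquiv.symm_apply_apply]
  have hτc : ContinuousOn τ D := by
    rw [continuousOn_iff_continuous_domRestrict, continuous_iff_seqContinuous]
    intro u x hux
    rw [tendsto_subtype_rng]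
    have hτval : ∀ x : D, ((D.domRestrict τ x : A) : WeakSpace ℝ X) = toWeakSpace ℝ X (T x) :=
      fun x => by simp [τ, Set.domRestrict]
    simp only [Function.comp_apply, hτval]
    refine WeakConv.tendsto_toWeakSpace (u := fun n => T (u n)) ?_
    exact hwsc (fun n => u n) x (fun n => hDS (u n).2) (hDS x.2)
      (.of_tendsto ((continuous_subtype_val.tendsto x).comp hux))
  choose x hxD hx using fun n : ℕ => exists_approx_fixedPoint_of_compact ⟨x₀, hx₀⟩ hDconv
    (fun a : A => hAD a a.2) hτc (Nat.one_div_pos_of_nat (α := ℝ) (n := n))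
  obtain ⟨a, -, φ, hφ, hlim⟩ := isCompact_univ.tendsto_subseq fun n => Set.mem_univ (τ (x n))
  have hTlim : WeakConv (fun n => T (x (φ n))) (j a) := by
    intro f
    have := ((hjc f).tendsto a).comp hlim
    refine this.congr fun n => ?_
    simp only [Function.comp_apply, hjτ _ (hxD _)]
  have hdiff : ∀ f : X →L[ℝ] ℝ, Tendsto (fun n => f (x n) - f (T (x n))) atTop (𝓝 0) := by
    intro f
    rw [Metric.tendsto_atTop]
    intro η hη
    obtain ⟨δ, hδ, hfδ⟩ := Metric.uniformContinuous_iff.1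
      (CompactSpace.uniformContinuous_of_continuous (hjc f)) (η / 2) (half_pos hη)
    obtain ⟨N, hN⟩ := exists_nat_one_div_lt hδ
    refine ⟨N, fun n hn => ?_⟩
    have h := hx n f (η / 2) fun y z hyz => (hfδ (hyz.trans
      ((Nat.one_div_le_one_div hn).trans_lt hN))).le
    change |f (x n) - f (j (τ (x n)))| ≤ η / 2 at h
    rw [hjτ _ (hxD n)] at h
    rw [Real.dist_eq, sub_zero]
    linarith
  have hxlim : WeakConv (fun n => x (φ n)) (j a) := by
    intro f
    have := ((hdiff f).comp hφ.tendsto_atTop).add (hTlim f)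
    rw [zero_add] at this
    refine this.congr fun n => ?_
    simp
  have hjS : j a ∈ S := hDS (hAD a a.2)
  exact ⟨j a, hjS, (hwsc _ _ (fun n => hDS (hxD _)) hjS hxlim).unique hTlim⟩
end

section
/- Let X be a real Banach algebra satisfying the sequential condition (P). If K and K′ are weakly compact subsets of X, then the product set K·K′ = {x·x′ : x ∈ K, x′ ∈ K′} is weakly compact. -/
open Filter Topology Pointwise

variable {X : Type*} [NormedAddCommGroup X] [NormedSpace ℝ X]

/-- Condition (P): the product of weakly convergent sequences converges weakly to the
product of the limits. -/
def CondP (X : Type*) [NormedRing X] [NormedAlgebra ℝ X] : Prop :=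
  ∀ (u v : ℕ → X) (x y : X), WeakConv u x → WeakConv v y →
    WeakConv (fun n => u n * v n) (x * y)

section WeakTopology

variable {E : Type*} [NormedAddCommGroup E] [NormedSpace ℝ E]

theorem continuous_dual_apply_weakSpace (f : E →L[ℝ] ℝ) :
    Continuous fun z : WeakSpace ℝ E => f ((toWeakSpace ℝ E).symm z) :=
  WeakBilin.eval_continuous (topDualPairing ℝ E).flip f

theorem continuousOn_weakSpace_of_forall_dual {α : Type*} [TopologicalSpace α] {s : Set α}
    {m : α → WeakSpace ℝ E}
    (h : ∀ f : E →L[ℝ] ℝ, ContinuousOn (fun a => f ((toWeakSpace ℝ E).symm (m a))) s) :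
    ContinuousOn m s := by
  rw [continuousOn_iff_continuous_domRestrict]
  exact WeakBilin.continuous_of_continuous_eval _
    fun f => continuousOn_iff_continuous_domRestrict.1 (h f)

/-- Quantitative countable tightness: a finite subset of `A` suffices to approximate a point of the
weak closure of `A` against every `n`-tuple of functionals in the dual unit ball. -/
theorem exists_finite_approx_of_mem_closure {A : Set (WeakSpace ℝ E)} {x : WeakSpace ℝ E}
    (hx : x ∈ closure A) (n : ℕ) {ε : ℝ} (hε : 0 < ε) :
    ∃ D ⊆ A, D.Finite ∧ ∀ φ : Fin n → (E →L[ℝ] ℝ), (∀ i, ‖φ i‖ ≤ 1) →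
      ∃ a ∈ D, ∀ i, |φ i ((toWeakSpace ℝ E).symm a) - φ i ((toWeakSpace ℝ E).symm x)| < ε := by
  have hB : IsCompact (Set.univ.pi fun _ : Fin n =>
      (WeakDual.toStrongDual ⁻¹' Metric.closedBall (0 : StrongDual ℝ E) 1 :
        Set (WeakDual ℝ E))) :=
    isCompact_univ_pi fun _ => WeakDual.isCompact_closedBall 0 1
  obtain ⟨D, hDA, hDfin, hD⟩ := hB.elim_finite_subcover_image (b := A)
    (c := fun a => {φ : Fin n → WeakDual ℝ E | ∀ i,
      |φ i ((toWeakSpace ℝ E).symm a) - φ i ((toWeakSpace ℝ E).symm x)| < ε})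
    (fun a _ => by
      simp only [Set.ofPred_forall]
      refine isOpen_iInter_of_finite fun i => isOpen_lt ?_ continuous_const
      exact (((WeakDual.eval_continuous _).comp (continuous_apply i)).sub
        ((WeakDual.eval_continuous _).comp (continuous_apply i))).abs)
    (fun φ _ => by
      have hopen : IsOpen {z : WeakSpace ℝ E | ∀ i,
          |φ i ((toWeakSpace ℝ E).symm z) - φ i ((toWeakSpace ℝ E).symm x)| < ε} := by
        simp only [Set.ofPred_forall]
        refine isOpen_iInter_of_finite fun i => isOpen_lt ?_ continuous_const
        exact ((continuous_dual_apply_weakSpace (WeakDual.toStrongDual (φ i))).sub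
          continuous_const).abs
      obtain ⟨a, ha, haA⟩ := mem_closure_iff.1 hx _ hopen (fun i => by simpa using hε)
      exact Set.mem_biUnion haA ha)
  refine ⟨D, hDA, hDfin, fun φ hφ => ?_⟩
  have hmem := hD (show (fun i => StrongDual.toWeakDual (φ i)) ∈ _ from
    fun i _ => mem_closedBall_zero_iff.2 (hφ i))
  simpa using hmem

/-- A separable set of vectors is separated from `0` by a sequence in the dual unit ball. -/
theorem exists_seq_dual_separating {S : Set E} (hS : TopologicalSpace.IsSeparable S) :
    ∃ g : ℕ → (E →L[ℝ] ℝ), (∀ k, ‖g k‖ ≤ 1) ∧ ∀ z ∈ S, (∀ k, g k z = 0) → z = 0 := by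
  obtain ⟨c, hc, hSc⟩ := hS
  rcases c.eq_empty_or_nonempty with rfl | hne
  · exact ⟨0, by simp, fun z hz => by simpa using hSc hz⟩
  obtain ⟨w, rfl⟩ := hc.exists_eq_range hne
  choose g hg1 hg using fun k => exists_dual_vector'' ℝ (w k)
  refine ⟨g, hg1, fun z hz hgz => norm_le_zero_iff.1 (le_of_forall_pos_le_add fun ε hε => ?_)⟩
  obtain ⟨_, ⟨k, rfl⟩, hk⟩ := Metric.mem_closure_iff.1 (hSc hz) (ε / 2) (half_pos hε)
  have hw : ‖w k‖ ≤ dist z (w k) := by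
    have h := (g k).le_of_opNorm_le (hg1 k) (w k - z)
    rw [map_sub, hgz k, hg k, sub_zero, one_mul] at h
    simpa [dist_eq_norm_sub'] using h
  have := norm_le_norm_add_norm_sub' z (w k)
  rw [dist_eq_norm] at *
  linarith

/-- Weakly compact subsets of normed spaces are Fréchet–Urysohn. -/
theorem exists_seq_tendsto_of_mem_closure {A C : Set (WeakSpace ℝ E)} {x : WeakSpace ℝ E}
    (hC : IsCompact C) (hAC : A ⊆ C) (hx : x ∈ closure A) :
    ∃ d : ℕ → WeakSpace ℝ E, (∀ n, d n ∈ A) ∧ Tendsto d atTop (𝓝 x) := by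
  choose D hDA hDfin hD using fun n : ℕ =>
    exists_finite_approx_of_mem_closure hx n (Nat.one_div_pos_of_nat (α := ℝ) (n := n))
  let e := (toWeakSpace ℝ E).symm
  let Y : Submodule ℝ E := Submodule.span ℝ (e '' insert x (⋃ n, D n))
  have hYsep : TopologicalSpace.IsSeparable (closure (Y : Set E)) :=
    (Set.Countable.isSeparable (((Set.countable_iUnion fun n =>
      (hDfin n).countable).insert x).image e)).span.closure
  obtain ⟨g, hg1, hg⟩ := exists_seq_dual_separating hYsep
  choose d hdD hd using fun n => hD n (fun i => g i) (fun i => hg1 i)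
  have hlim : ∀ k, Tendsto (fun n => g k (e (d n))) atTop (𝓝 (g k (e x))) := fun k => by
    rw [tendsto_iff_dist_tendsto_zero]
    refine squeeze_zero' (Eventually.of_forall fun _ => dist_nonneg) ?_
      (tendsto_one_div_add_atTop_nhds_zero_nat (𝕜 := ℝ))
    filter_upwards [eventually_gt_atTop k] with n hn
    exact (hd n ⟨k, hn⟩).le
  have hmemY : ∀ z ∈ insert x (⋃ n, D n), e z ∈ Y := fun z hz =>
    Submodule.subset_span ⟨z, hz, rfl⟩
  have hdY : ∀ n, e (d n) ∈ Y := fun n =>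
    hmemY _ (Or.inr (Set.mem_iUnion.2 ⟨n, hdD n⟩))
  refine ⟨d, fun n => hDA n (hdD n), hC.tendsto_nhds_of_unique_mapClusterPt
    (Eventually.of_forall fun n => hAC (hDA n (hdD n))) fun y _ hy => ?_⟩
  have hyY : e y ∈ closure (Y : Set E) := by
    have hcl : y ∈ closure (toWeakSpace ℝ E '' (Y : Set E)) :=
      ClusterPt.mem_closure_of_mem hy _ (mem_map.2 <| Eventually.of_forall fun n =>
        ⟨e (d n), hdY n, by simp [e]⟩)
    rw [← Y.convex.toWeakSpace_closure ℝ] at hcl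
    obtain ⟨z, hz, rfl⟩ := hcl
    simpa [e] using hz
  have hgy : ∀ k, g k (e y) = g k (e x) := fun k => by
    have h := hy.continuousAt_comp (continuous_dual_apply_weakSpace (g k)).continuousAt
    exact eq_of_nhds_neBot (ClusterPt.mono h (hlim k))
  refine e.injective (sub_eq_zero.1 (hg _ ?_ fun k => by rw [map_sub, hgy k, sub_self]))
  exact Y.topologicalClosure.sub_mem hyY
    (Y.le_topologicalClosure (hmemY x (Set.mem_insert _ _)))

theorem tendsto_weakSpace_iff_weakConv {d : ℕ → WeakSpace ℝ E} {x : WeakSpace ℝ E} :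
    Tendsto d atTop (𝓝 x) ↔
      WeakConv (fun n => (toWeakSpace ℝ E).symm (d n)) ((toWeakSpace ℝ E).symm x) := by
  refine ⟨fun h f => ((continuous_dual_apply_weakSpace f).tendsto x).comp h, fun h => ?_⟩
  refine (WeakBilin.tendsto_iff_forall_eval_tendsto _ fun a b hab => ?_).2 h
  exact (SeparatingDual.eq_iff_forall_dual_eq (R := ℝ)).2 fun f => LinearMap.congr_fun hab f

/-- On weakly compact sets, weak sequential continuity implies weak continuity. -/
theorem continuousOn_of_forall_seq {β : Type*} [TopologicalSpace β] {C : Set (WeakSpace ℝ E)}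
    (hC : IsCompact C) {m : WeakSpace ℝ E → β}
    (hm : ∀ (d : ℕ → WeakSpace ℝ E) (x : WeakSpace ℝ E), Tendsto d atTop (𝓝 x) →
      Tendsto (fun n => m (d n)) atTop (𝓝 (m x))) :
    ContinuousOn m C := by
  intro x _ V hV
  by_contra hne
  have hx : x ∈ closure (C \ m ⁻¹' V) := by
    rw [mem_closure_iff_frequently]
    intro h
    refine hne (mem_map.2 ?_)
    filter_upwards [mem_nhdsWithin_of_mem_nhds h, self_mem_nhdsWithin] with z hz hzC
    exact not_not.1 fun hzV => hz ⟨hzC, hzV⟩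
  obtain ⟨d, hdA, hd⟩ := exists_seq_tendsto_of_mem_closure hC Set.sdiff_subset hx
  obtain ⟨n, hn⟩ := ((hm d x hd).eventually hV).exists
  exact (hdA n).2 hn

theorem WeaklyCompact.prod {F : Type*} [NormedAddCommGroup F] [NormedSpace ℝ F]
    {K : Set E} {L : Set F} (hK : WeaklyCompact K) (hL : WeaklyCompact L) :
    WeaklyCompact (K ×ˢ L) := by
  let p : WeakSpace ℝ E × WeakSpace ℝ F → WeakSpace ℝ (E × F) := fun z =>
    toWeakSpace ℝ (E × F) ((toWeakSpace ℝ E).symm z.1, (toWeakSpace ℝ F).symm z.2)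
  have hp : ContinuousOn p ((toWeakSpace ℝ E '' K) ×ˢ (toWeakSpace ℝ F '' L)) := by
    refine continuousOn_weakSpace_of_forall_dual fun f => Continuous.continuousOn ?_
    have h := ((continuous_dual_apply_weakSpace (f.comp (.inl ℝ E F))).comp continuous_fst).add
      ((continuous_dual_apply_weakSpace (f.comp (.inr ℝ E F))).comp
        (continuous_snd (X := WeakSpace ℝ E)))
    refine h.congr fun z => ?_
    simp [p, ← map_add]
  have himage : toWeakSpace ℝ (E × F) '' (K ×ˢ L) =
      p '' ((toWeakSpace ℝ E '' K) ×ˢ (toWeakSpace ℝ F '' L)) := by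
    rw [Set.prod_image_image_eq, Set.image_image]
    simp [p]
  unfold WeaklyCompact
  rw [himage]
  exact (IsCompact.prod hK hL).image_of_continuousOn hp

end WeakTopology

/-- In a real Banach algebra satisfying the sequential condition (P), the
product of two weakly compact subsets is weakly compact. -/
theorem weaklyCompact_mul {X : Type*} [NormedRing X] [NormedAlgebra ℝ X]
    [CompleteSpace X] (hP : CondP X) (K K' : Set X)
    (hK : WeaklyCompact K) (hK' : WeaklyCompact K') :
    WeaklyCompact (K * K') := by
  let m : WeakSpace ℝ (X × X) → WeakSpace ℝ X := fun z =>
    toWeakSpace ℝ X (((toWeakSpace ℝ (X × X)).symm z).1 * ((toWeakSpace ℝ (X × X)).symm z).2)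
  have hm : ContinuousOn m (toWeakSpace ℝ (X × X) '' (K ×ˢ K')) := by
    refine continuousOn_of_forall_seq (hK.prod hK') fun d z hd => ?_
    rw [tendsto_weakSpace_iff_weakConv] at hd ⊢
    exact hP _ _ _ _ (fun f => hd (f.comp (.fst ℝ X X))) (fun f => hd (f.comp (.snd ℝ X X)))
  have himage : toWeakSpace ℝ X '' (K * K') = m '' (toWeakSpace ℝ (X × X) '' (K ×ˢ K')) := by
    rw [← Set.image_mul_prod, Set.image_image, Set.image_image]
    simp [m]
  unfold WeaklyCompact
  rw [himage]
  exact (hK.prod hK').image_of_continuousOn hm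
end

section
/- Let X be a real Banach space and let T : X → X be weakly sequentially continuous and Lipschitz with constant k, 0 ≤ k < 1, i.e., ‖Tx − Ty‖ ≤ k‖x − y‖ for all x, y ∈ X. Then for every bounded subset S of X one has μ(T(S)) ≤ k·μ(S), where μ denotes the De Blasi measure of weak noncompactness. -/
open Filter Topology Pointwise

variable {X : Type*} [NormedAddCommGroup X] [NormedSpace ℝ X]

theorem WeakSpace.continuous_eval (f : StrongDual ℝ X) :
    Continuous fun y : WeakSpace ℝ X => f ((toWeakSpace ℝ X).symm y) :=
  WeakBilin.eval_continuous _ f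

/-- The weak topology of a normed space has countable tightness. -/
theorem WeakSpace.exists_countable_mem_closure {A : Set (WeakSpace ℝ X)} {x : WeakSpace ℝ X}
    (hx : x ∈ closure A) : ∃ C ⊆ A, C.Countable ∧ x ∈ closure C := by
  have key : ∀ n m : ℕ, ∃ F : Finset A, ∀ f : Fin n → StrongDual ℝ X, (∀ i, ‖f i‖ ≤ m) →
      ∃ a ∈ F, ∀ i, |f i ((toWeakSpace ℝ X).symm (a - x))| < 1 := by
    intro n m
    have hcpt : IsCompact (Set.univ.pi fun _ : Fin n =>
        WeakDual.toStrongDual ⁻¹' Metric.closedBall (0 : StrongDual ℝ X) m) :=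
      isCompact_univ_pi fun _ => WeakDual.isCompact_closedBall _ _
    obtain ⟨F, hF⟩ := hcpt.elim_finite_subcover
      (fun a : A => {f : Fin n → WeakDual ℝ X |
        ∀ i, |f i ((toWeakSpace ℝ X).symm (a - x))| < 1})
      (fun a => by
        simp only [Set.ofPred_forall]
        exact isOpen_iInter_of_finite fun i => isOpen_lt
          ((WeakDual.eval_continuous _).comp (continuous_apply i)).abs continuous_const)
      (fun f _ => by
        have hopen : IsOpen {y : WeakSpace ℝ X |
            ∀ i, |f i ((toWeakSpace ℝ X).symm (y - x))| < 1} := by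
          simp only [Set.ofPred_forall]
          refine isOpen_iInter_of_finite fun i => isOpen_lt ?_ continuous_const
          exact ((continuous_eval (f i).toStrongDual).comp
            (continuous_id.sub continuous_const)).abs
        obtain ⟨a, ha, haA⟩ := mem_closure_iff.1 hx _ hopen (by simp)
        exact Set.mem_iUnion.2 ⟨⟨a, haA⟩, ha⟩)
    refine ⟨F, fun f hf => ?_⟩
    have hmem := hF (a := fun i => StrongDual.toWeakDual (f i)) (by
      intro i _
      simpa using hf i)
    simpa using hmem
  choose F hF using key
  refine ⟨⋃ n, ⋃ m, (Subtype.val '' (F n m : Set A)), ?_, ?_, ?_⟩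
  · simp only [Set.iUnion_subset_iff]
    rintro n m _ ⟨a, -, rfl⟩
    exact a.2
  · exact Set.countable_iUnion fun n => Set.countable_iUnion fun m =>
      ((F n m).countable_toSet).image _
  · rw [mem_closure_iff_nhds]
    intro U hU
    obtain ⟨s, r, hr, hsU⟩ :=
      ((topDualPairing ℝ X).flip.weakBilin_withSeminorms.mem_nhds_iff x U).1 hU
    obtain ⟨m, hm⟩ := exists_nat_ge (∑ f ∈ s, ‖(r⁻¹ • f : StrongDual ℝ X)‖)
    obtain ⟨a, haF, ha⟩ := hF s.card m
      (fun i => r⁻¹ • (s.equivFin.symm i : StrongDual ℝ X)) (fun i =>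
        (Finset.single_le_sum (f := fun f : StrongDual ℝ X => ‖(r⁻¹ • f : StrongDual ℝ X)‖)
          (fun _ _ => norm_nonneg _) (s.equivFin.symm i).2).trans hm)
    refine ⟨a, hsU ?_, Set.mem_iUnion₂.2 ⟨_, _, a, haF, rfl⟩⟩
    refine Seminorm.finset_sup_apply_lt hr fun f hf => ?_
    have h := ha (s.equivFin ⟨f, hf⟩)
    rw [Equiv.symm_apply_apply, FunLike.coe_smul, Pi.smul_apply, smul_eq_mul, abs_mul,
      abs_of_pos (inv_pos.2 hr), inv_mul_lt_iff₀ hr, mul_one] at h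
    exact h

/-- A countable family of functionals separates the points of a separable closed subspace. -/
theorem exists_countable_separating_strongDual (Y : Submodule ℝ X)
    (hY : TopologicalSpace.IsSeparable (Y : Set X)) :
    ∃ D : Set (StrongDual ℝ X), D.Countable ∧
      ∀ y ∈ Y, ∀ z ∈ Y, (∀ f ∈ D, f y = f z) → y = z := by
  obtain ⟨c, hc, hYc⟩ := hY
  choose g hg1 hg using fun x : X => exists_dual_vector'' ℝ x
  refine ⟨g '' c, hc.image g, fun y hy z hz h => ?_⟩
  rw [← sub_eq_zero, ← norm_le_zero_iff]
  refine le_of_forall_pos_le_add fun ε hε => ?_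
  obtain ⟨d, hd, hdist⟩ := Metric.mem_closure_iff.1 (hYc (Y.sub_mem hy hz)) (ε / 2) (half_pos hε)
  rw [dist_eq_norm] at hdist
  have h0 : g d (y - z) = 0 := by rw [map_sub, h _ ⟨d, hd, rfl⟩, sub_self]
  have h1 : ‖d‖ ≤ ‖y - z - d‖ := by
    calc ‖d‖ = |g d (y - z - d)| := by simp [map_sub _ (y - z) d, h0, hg]
      _ ≤ 1 * ‖y - z - d‖ := (g d).le_of_opNorm_le (hg1 d) _
      _ = _ := one_mul _
  have h2 := norm_le_norm_sub_add (y - z) d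
  linarith

/-- Weakly compact subsets of a normed space are Fréchet-Urysohn in the weak topology. -/
theorem WeakSpace.exists_seq_tendsto_of_isCompact {K A : Set (WeakSpace ℝ X)} (hK : IsCompact K)
    (hAK : A ⊆ K) {x : WeakSpace ℝ X} (hx : x ∈ closure A) :
    ∃ u : ℕ → WeakSpace ℝ X, (∀ n, u n ∈ A) ∧ Tendsto u atTop (𝓝 x) := by
  obtain ⟨C, hCA, hC, hxC⟩ := exists_countable_mem_closure hx
  set Y : Submodule ℝ X := (Submodule.span ℝ (toWeakSpace ℝ X ⁻¹' C)).topologicalClosure with hYdef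
  have hsep : TopologicalSpace.IsSeparable (Y : Set X) := by
    have : (toWeakSpace ℝ X ⁻¹' C).Countable := hC.preimage (toWeakSpace ℝ X).injective
    exact this.isSeparable.span.closure
  obtain ⟨D, hD, hDsep⟩ := exists_countable_separating_strongDual Y hsep
  have hYclosed : IsClosed (toWeakSpace ℝ X '' (Y : Set X)) := by
    have h := Convex.toWeakSpace_closure ℝ (Submodule.span ℝ (toWeakSpace ℝ X ⁻¹' C)).convex
    rw [hYdef, Submodule.topologicalClosure_coe, h]
    exact isClosed_closure
  have hCY : C ⊆ toWeakSpace ℝ X '' (Y : Set X) := fun a ha =>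
    ⟨(toWeakSpace ℝ X).symm a,
      Submodule.le_topologicalClosure _ (Submodule.subset_span (by simpa using ha)),
      (toWeakSpace ℝ X).apply_symm_apply a⟩
  obtain ⟨L, hL⟩ : ∃ L : Set (WeakSpace ℝ X), L = K ∩ toWeakSpace ℝ X '' (Y : Set X) :=
    ⟨_, rfl⟩
  have hLc : IsCompact L := hL ▸ hK.inter_right hYclosed
  have hCL : C ⊆ L := hL ▸ Set.subset_inter (hCA.trans hAK) hCY
  have hxL : x ∈ L := closure_minimal hCL hLc.isClosed hxC
  have : CompactSpace L := isCompact_iff_compactSpace.1 hLc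
  have : Countable D := hD.to_subtype
  have hcont : Continuous fun (y : L) (f : D) => f.1 ((toWeakSpace ℝ X).symm y.1) :=
    continuous_pi fun f => (WeakSpace.continuous_eval f.1).comp continuous_subtype_val
  have hinj : Function.Injective fun (y : L) (f : D) => f.1 ((toWeakSpace ℝ X).symm y.1) := by
    have hLY (y : L) : (toWeakSpace ℝ X).symm y ∈ Y := by
      obtain ⟨-, z, hz, hzy⟩ := hL.subset y.2
      rwa [← hzy, LinearEquiv.symm_apply_apply]
    intro y z h
    exact Subtype.ext <| (toWeakSpace ℝ X).symm.injective <|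
      hDsep _ (hLY y) _ (hLY z) fun f hf => congrFun h ⟨f, hf⟩
  have : TopologicalSpace.MetrizableSpace L :=
    (hcont.isClosedEmbedding hinj).isEmbedding.metrizableSpace
  have hxC' : (⟨x, hxL⟩ : L) ∈ closure (Subtype.val ⁻¹' C) := by
    rw [closure_subtype, Subtype.image_preimage_coe, Set.inter_eq_right.2 hCL]
    exact hxC
  obtain ⟨u, huC, hu⟩ := mem_closure_iff_seq_limit.1 hxC'
  exact ⟨fun n => u n, fun n => hCA (huC n), (continuous_subtype_val.tendsto _).comp hu⟩

theorem weakConv_iff_tendsto {u : ℕ → X} {x : X} :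
    WeakConv u x ↔ Tendsto (fun n => toWeakSpace ℝ X (u n)) atTop (𝓝 (toWeakSpace ℝ X x)) := by
  have hinj : Function.Injective (topDualPairing ℝ X).flip := fun a b hab =>
    (SeparatingDual.eq_iff_forall_dual_eq (R := ℝ)).2 fun f => DFunLike.congr_fun hab f
  exact (WeakBilin.tendsto_iff_forall_eval_tendsto _ hinj).symm

/-- A weakly sequentially continuous map sends weakly compact sets to weakly compact sets. -/
theorem WeaklyCompact.image_of_weakConv {K : Set X} (hK : WeaklyCompact K) {T : X → X}
    (hT : ∀ (u : ℕ → X) (x : X), WeakConv u x → WeakConv (fun n => T (u n)) (T x)) :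
    WeaklyCompact (T '' K) := by
  have : FrechetUrysohnSpace (toWeakSpace ℝ X '' K) := ⟨fun s x hx => by
    obtain ⟨u, hus, hu⟩ := WeakSpace.exists_seq_tendsto_of_isCompact hK
      (Subtype.coe_image_subset _ s) (closure_subtype.1 hx)
    choose v hv hvu using hus
    refine ⟨v, hv, tendsto_subtype_rng.2 ?_⟩
    simpa only [hvu] using hu⟩
  have hcont : ContinuousOn (fun y => toWeakSpace ℝ X (T ((toWeakSpace ℝ X).symm y)))
      (toWeakSpace ℝ X '' K) := by
    rw [continuousOn_iff_continuous_domRestrict, continuous_iff_seqContinuous]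
    intro u x hu
    have h : WeakConv (fun n => (toWeakSpace ℝ X).symm (u n)) ((toWeakSpace ℝ X).symm x) := by
      rw [weakConv_iff_tendsto]
      simpa using tendsto_subtype_rng.1 hu
    exact weakConv_iff_tendsto.1 (hT _ _ h)
  have himage := IsCompact.image_of_continuousOn hK hcont
  rw [Set.image_image] at himage
  simpa only [WeaklyCompact, Set.image_image, LinearEquiv.symm_apply_apply] using himage

/-- If `T : X → X` is weakly sequentially continuous and Lipschitz with
constant `0 ≤ k < 1` on a real Banach space `X`, then `μ(T(S)) ≤ k·μ(S)` for every
bounded subset `S` of `X`. -/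
theorem deBlasi_image_le_of_lipschitz {X : Type*} [NormedAddCommGroup X]
    [NormedSpace ℝ X] [CompleteSpace X] (T : X → X) (k : ℝ) (hk0 : 0 ≤ k) (hk1 : k < 1)
    (hlip : ∀ x y : X, ‖T x - T y‖ ≤ k * ‖x - y‖)
    (hwsc : ∀ (u : ℕ → X) (x : X), WeakConv u x → WeakConv (fun n => T (u n)) (T x))
    (S : Set X) (hS : Bornology.IsBounded S) :
    deBlasi (T '' S) ≤ k * deBlasi S := by
  obtain ⟨R, hR0, hR⟩ := hS.exists_pos_norm_le
  rw [deBlasi, deBlasi, ← smul_eq_mul, ← Real.sInf_smul_of_nonneg hk0]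
  refine le_csInf (Set.Nonempty.smul_set ⟨R, hR0.le, {0}, ?_, ?_⟩) ?_
  · simp [WeaklyCompact]
  · intro x hx
    simpa using hR x hx
  rintro _ ⟨r, ⟨hr, K, hK, hSK⟩, rfl⟩
  refine csInf_le ⟨0, fun _ h => h.1⟩
    ⟨mul_nonneg hk0 hr, T '' K, hK.image_of_weakConv hwsc, ?_⟩
  rintro _ ⟨x, hx, rfl⟩
  obtain ⟨y, hy, b, hb, rfl⟩ := hSK hx
  refine ⟨T y, ⟨y, hy, rfl⟩, T (y + b) - T y, ?_, add_sub_cancel _ _⟩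
  rw [mem_closedBall_zero_iff] at hb ⊢
  refine (hlip _ _).trans ?_
  rw [add_sub_cancel_left]
  exact mul_le_mul_of_nonneg_left hb hk0
end
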